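/- arXiv:2403.17960 — 2 statements merged into one kernel-verified Lean document; each statement's English description precedes it below -/
import Mathlib

section
/- Let G be a finite group in which all maximal chains in G of every subgroup of prime order have the same length. If G is non-supersolvable, then the Fitting subgroup F(G) is a Sylow p-subgroup of the commutator subgroup G', where p is the prime dividing |F(G)|. -/
/-- A maximal chain of `H` in the ambient group of length `r`: a chain
`H = c 0 < c 1 < ... < c r = ⊤` where each `c i` is a maximal subgroup of `c (i+1)`,
i.e. each step is a covering relation in the subgroup lattice. -/
def IsMaxChainOf {G : Type*} [Group G] (H : Subgroup G) (r : ℕ) (c : ℕ → Subgroup G) : Prop :=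
  c 0 = H ∧ c r = ⊤ ∧ ∀ i < r, c i ⋖ c (i + 1)

/-- All maximal chains of `H` in the ambient group have the same length. -/
def AllMaxChainsSameLength {G : Type*} [Group G] (H : Subgroup G) : Prop :=
  ∀ (r s : ℕ) (c d : ℕ → Subgroup G),
    IsMaxChainOf H r c → IsMaxChainOf H s d → r = s


/-- A group is supersolvable if it has a normal series (all terms normal in the whole
group) with cyclic factors.  The factor `s (i+1) / s i` being cyclic is encoded as:
some single element `g` together with `s i` generates `s (i+1)`. -/
def IsSupersolvable (G : Type*) [Group G] : Prop :=
  ∃ (n : ℕ) (s : ℕ → Subgroup G), s 0 = ⊥ ∧ s n = ⊤ ∧ (∀ i, (s i).Normal) ∧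
    ∀ i < n, ∃ g : G, s i ⊔ Subgroup.zpowers g = s (i + 1)

/-- `CoverChain a b n` says that there is a chain of `n` covering relations from `a` to `b`. -/
inductive CoverChain {α : Type*} [Preorder α] : α → α → ℕ → Prop
  | refl (a : α) : CoverChain a a 0
  | cons {a b c : α} {n : ℕ} : a ⋖ b → CoverChain b c n → CoverChain a c (n + 1)

namespace CoverChain

variable {α β : Type*}

theorem le [Preorder α] {a b : α} {n : ℕ} (h : CoverChain a b n) : a ≤ b := by
  induction h with
  | refl => exact le_rfl
  | cons h _ ih => exact h.le.trans ih

theorem single [Preorder α] {a b : α} (h : a ⋖ b) : CoverChain a b 1 := cons h (refl b)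

theorem trans [Preorder α] {a b c : α} {m n : ℕ} (h : CoverChain a b m)
    (h' : CoverChain b c n) : CoverChain a c (m + n) := by
  induction h with
  | refl => simpa using h'
  | cons h _ ih => rw [Nat.add_right_comm]; exact cons h (ih h')

theorem image [PartialOrder α] [PartialOrder β] (f : α ↪o β) (hf : (Set.range f).OrdConnected)
    {a b : α} {n : ℕ} (h : CoverChain a b n) : CoverChain (f a) (f b) n := by
  induction h with
  | refl => exact refl _
  | cons h _ ih => exact cons (h.image f hf) ih

theorem exists_of_le [PartialOrder α] [Finite α] {a b : α} (h : a ≤ b) :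
    ∃ n, CoverChain a b n := by
  induction a using (wellFounded_gt (α := α)).induction with
  | _ a ih =>
    obtain rfl | hlt := h.eq_or_lt
    · exact ⟨0, refl _⟩
    · obtain ⟨c, hac, hcb⟩ := exists_covBy_le_of_lt hlt
      obtain ⟨n, hn⟩ := ih c hac.lt hcb
      exact ⟨n + 1, cons hac hn⟩

theorem exists_isMaxChainOf {G : Type*} [Group G] {H K : Subgroup G} {n : ℕ}
    (h : CoverChain H K n) (hK : K = ⊤) : ∃ c, IsMaxChainOf H n c := by
  induction h with
  | refl a => exact ⟨fun _ => a, rfl, hK, fun i hi => absurd hi (Nat.not_lt_zero i)⟩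
  | @cons a b c n h _ ih =>
    obtain ⟨d, h0, h1, h2⟩ := ih hK
    refine ⟨fun i => Nat.casesOn i a d, rfl, h1, fun i hi => ?_⟩
    cases i with
    | zero => simpa [h0] using h
    | succ i => exact h2 i (by omega)

end CoverChain

/-- From `H` on, all covering relations between subgroups have prime index. -/
def PrimeStepsAbove {G : Type*} [Group G] (H : Subgroup G) : Prop :=
  ∀ A B : Subgroup G, H ≤ A → A ⋖ B → (A.relIndex B).Prime

/-- All chains of covers from `H` to the whole group have the same length. -/
def UniformAbove {G : Type*} [Group G] (H : Subgroup G) : Prop :=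
  ∀ r s : ℕ, CoverChain H ⊤ r → CoverChain H ⊤ s → r = s

theorem AllMaxChainsSameLength.uniformAbove {G : Type*} [Group G] {H : Subgroup G}
    (h : AllMaxChainsSameLength H) : UniformAbove H := fun _ _ hr hs =>
  have ⟨c, hc⟩ := hr.exists_isMaxChainOf rfl
  have ⟨d, hd⟩ := hs.exists_isMaxChainOf rfl
  h _ _ c d hc hd

section Length

open ArithmeticFunction

open scoped ArithmeticFunction.Omega

variable {G : Type*} [Group G]

theorem PrimeStepsAbove.mono {H K : Subgroup G} (h : PrimeStepsAbove H) (hHK : H ≤ K) :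
    PrimeStepsAbove K := fun A B hA => h A B (hHK.trans hA)

theorem Subgroup.card_mul_relIndex_of_le {A B : Subgroup G} (h : A ≤ B) :
    Nat.card A * A.relIndex B = Nat.card B := by
  simpa using Subgroup.relIndex_mul_relIndex ⊥ A B bot_le h

variable [Finite G]

theorem Subgroup.relIndex_ne_zero_of_finite (A B : Subgroup G) : A.relIndex B ≠ 0 :=
  Subgroup.index_ne_zero_of_finite

theorem cardFactors_relIndex_add {A B C : Subgroup G} (h : A ≤ B) (h' : B ≤ C) :
    Ω (A.relIndex C) = Ω (A.relIndex B) + Ω (B.relIndex C) := by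
  rw [← Subgroup.relIndex_mul_relIndex A B C h h',
    cardFactors_mul (A.relIndex_ne_zero_of_finite B) (B.relIndex_ne_zero_of_finite C)]

theorem cardFactors_relIndex_pos {A B : Subgroup G} (h : A < B) : 0 < Ω (A.relIndex B) := by
  rw [cardFactors_pos_iff_one_lt]
  have h1 : A.relIndex B ≠ 1 := fun h1 => h.not_ge (Subgroup.relIndex_eq_one.1 h1)
  have h0 : A.relIndex B ≠ 0 := A.relIndex_ne_zero_of_finite B
  omega

theorem CoverChain.length_le {A B : Subgroup G} {n : ℕ} (h : CoverChain A B n) :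
    n ≤ Ω (A.relIndex B) := by
  induction h with
  | refl => simp
  | cons h h' ih =>
    rw [cardFactors_relIndex_add h.le h'.le]
    have := cardFactors_relIndex_pos h.lt
    omega

theorem PrimeStepsAbove.length_eq {H A B : Subgroup G} {n : ℕ} (hH : PrimeStepsAbove H)
    (h : CoverChain A B n) (hA : H ≤ A) : n = Ω (A.relIndex B) := by
  induction h with
  | refl => simp
  | cons h h' ih =>
    rw [cardFactors_relIndex_add h.le h'.le, cardFactors_eq_one_iff_prime.2 (hH _ _ hA h),
      ← ih (hA.trans h.le), add_comm]

theorem UniformAbove.primeStepsAbove {H : Subgroup G} (hH : UniformAbove H)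
    (h : CoverChain H ⊤ (Ω H.index)) : PrimeStepsAbove H := by
  intro A B hA hAB
  obtain ⟨m, hm⟩ := CoverChain.exists_of_le hA
  obtain ⟨n, hn⟩ := CoverChain.exists_of_le (le_top (a := B))
  have h1 := hH _ _ h (hm.trans (CoverChain.cons hAB hn))
  rw [← Subgroup.relIndex_top_right, cardFactors_relIndex_add hA le_top,
    cardFactors_relIndex_add hAB.le le_top] at h1
  have h2 := hm.length_le
  have h3 := hn.length_le
  have h4 := cardFactors_relIndex_pos hAB.lt
  exact cardFactors_eq_one_iff_prime.1 (by omega)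

/-- A uniform subgroup below a subgroup with prime steps, joined to it by prime steps,
has prime steps itself. -/
theorem UniformAbove.primeStepsAbove_of_chain {H K : Subgroup G} (hH : UniformAbove H)
    (h : CoverChain H K (Ω (H.relIndex K))) (hK : PrimeStepsAbove K) : PrimeStepsAbove H := by
  obtain ⟨n, hn⟩ := CoverChain.exists_of_le (le_top (a := K))
  apply hH.primeStepsAbove
  rw [← Subgroup.relIndex_top_right, cardFactors_relIndex_add h.le le_top,
    ← hK.length_eq hn le_rfl]
  exact h.trans hn

theorem Subgroup.covBy_of_prime_relIndex {A B : Subgroup G} (h : A ≤ B)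
    (hp : (A.relIndex B).Prime) : A ⋖ B := by
  refine ⟨lt_of_le_of_ne h ?_, fun C hAC hCB => ?_⟩
  · rintro rfl
    simp [Nat.not_prime_one] at hp
  · have h1 := cardFactors_relIndex_add hAC.le hCB.le
    rw [cardFactors_eq_one_iff_prime.2 hp] at h1
    have h2 := cardFactors_relIndex_pos hAC
    have h3 := cardFactors_relIndex_pos hCB
    omega

theorem UniformAbove.primeStepsAbove_of_prime {H K : Subgroup G} (hH : UniformAbove H)
    (h : H ≤ K) (hp : (H.relIndex K).Prime) (hK : PrimeStepsAbove K) : PrimeStepsAbove H := by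
  refine hH.primeStepsAbove_of_chain ?_ hK
  rw [cardFactors_eq_one_iff_prime.2 hp]
  exact .single (Subgroup.covBy_of_prime_relIndex h hp)

/-- In a `p`-group, every chain of covers has the maximal possible length. -/
theorem IsPGroup.prime_relIndex_of_covBy {p : ℕ} [hp : Fact p.Prime] {A B : Subgroup G}
    (hB : IsPGroup p B) (h : A ⋖ B) : (A.relIndex B).Prime := by
  obtain ⟨n, hn⟩ := IsPGroup.iff_card.1 (hB.to_le h.le)
  obtain ⟨m, hm⟩ := IsPGroup.iff_card.1 hB
  have hcard : Nat.card (A.subgroupOf B) = p ^ n := by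
    rw [Nat.card_congr (Subgroup.subgroupOfEquivOfLe h.le).toEquiv, hn]
  have hlt : n < m := by
    have := Subgroup.card_le_of_le h.le
    rw [hn, hm, Nat.pow_le_pow_iff_right hp.out.one_lt] at this
    refine lt_of_le_of_ne this fun hnm => h.lt.ne (Subgroup.eq_of_le_of_card_ge h.le ?_)
    rw [hn, hm, hnm]
  obtain ⟨K, hK, hAK⟩ := Sylow.exists_subgroup_card_pow_succ
    (by rw [hm]; exact pow_dvd_pow p hlt) hcard
  have hle : A ≤ K.map B.subtype := fun x hx => ⟨⟨x, h.le hx⟩, hAK hx, rfl⟩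
  have hcK : Nat.card (K.map B.subtype) = p ^ (n + 1) := by
    rw [Nat.card_congr (K.equivMapOfInjective _ B.subtype_injective).symm.toEquiv, hK]
  have hne : K.map B.subtype ≠ A := by
    intro heq
    rw [heq, hn] at hcK
    exact (Nat.pow_lt_pow_right hp.out.one_lt n.lt_succ_self).ne hcK
  have hKB : K.map B.subtype = B :=
    (h.eq_or_eq hle (Subgroup.map_subtype_le K)).resolve_left hne
  have h2 := Subgroup.card_mul_relIndex_of_le h.le
  rw [← hKB, hcK, hKB, hn, pow_succ] at h2
  rw [Nat.eq_of_mul_eq_mul_left (pow_pos hp.out.pos n) h2]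
  exact hp.out

end Length

theorem CoverChain.covBy {α : Type*} [Preorder α] {a b : α} (h : CoverChain a b 1) : a ⋖ b := by
  generalize hn : 1 = n at h
  cases h with
  | refl => omega
  | cons h h' =>
    obtain rfl : _ = 0 := (Nat.succ.inj hn).symm
    cases h'
    exact h

section Transfer

variable {G : Type*} [Group G]

theorem UniformAbove.mono [Finite G] {H K : Subgroup G} (h : UniformAbove H) (hHK : H ≤ K) :
    UniformAbove K := by
  intro r s hr hs
  obtain ⟨n, hn⟩ := CoverChain.exists_of_le hHK
  exact Nat.add_left_cancel (h _ _ (hn.trans hr) (hn.trans hs))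

theorem CoverChain.map_subtype {X : Subgroup G} {A B : Subgroup X} {n : ℕ}
    (h : CoverChain A B n) : CoverChain (A.map X.subtype) (B.map X.subtype) n := by
  refine h.image (OrderEmbedding.ofMapLEIff (fun A : Subgroup X => A.map X.subtype)
    fun _ _ => Subgroup.map_subtype_le_map_subtype) ⟨?_⟩
  rintro _ ⟨A, rfl⟩ _ ⟨B, rfl⟩ C ⟨_, hC⟩
  exact ⟨C.subgroupOf X, Subgroup.map_subgroupOf_eq_of_le (hC.trans (Subgroup.map_subtype_le B))⟩

theorem CoverChain.map_subtype_top {X : Subgroup G} {A : Subgroup X} {n m : ℕ}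
    (h : CoverChain A ⊤ n) (h' : CoverChain X ⊤ m) :
    CoverChain (A.map X.subtype) ⊤ (n + m) := by
  have := h.map_subtype
  rw [← MonoidHom.range_eq_map, Subgroup.range_subtype] at this
  exact this.trans h'

theorem CoverChain.map_equiv {G' : Type*} [Group G'] (e : G ≃* G') {A B : Subgroup G} {n : ℕ}
    (h : CoverChain A B n) : CoverChain (A.map e.toMonoidHom) (B.map e.toMonoidHom) n := by
  refine h.image e.mapSubgroup.toOrderEmbedding ?_
  rw [OrderIso.coe_toOrderEmbedding, e.mapSubgroup.range_eq]
  exact Set.ordConnected_univ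

theorem CoverChain.comap_mk' {N : Subgroup G} [N.Normal] {A B : Subgroup (G ⧸ N)} {n : ℕ}
    (h : CoverChain A B n) :
    CoverChain (A.comap (QuotientGroup.mk' N)) (B.comap (QuotientGroup.mk' N)) n := by
  refine h.image (OrderEmbedding.ofMapLEIff
    (fun A : Subgroup (G ⧸ N) => A.comap (QuotientGroup.mk' N))
    fun _ _ => Subgroup.comap_le_comap_of_surjective (QuotientGroup.mk'_surjective N)) ⟨?_⟩
  rintro _ ⟨A, rfl⟩ _ ⟨B, rfl⟩ C ⟨hC, _⟩
  refine ⟨C.map (QuotientGroup.mk' N), Subgroup.comap_map_eq_self ?_⟩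
  exact le_trans (Subgroup.ker_le_comap _ _) hC

theorem UniformAbove.quotient_bot [Finite G] {L N : Subgroup G} [N.Normal] (h : UniformAbove L)
    (hL : L ≤ N) : UniformAbove (⊥ : Subgroup (G ⧸ N)) := by
  intro r s hr hs
  have key : ∀ {n}, CoverChain (⊥ : Subgroup (G ⧸ N)) ⊤ n → CoverChain N ⊤ n := fun hn => by
    have := hn.comap_mk'
    rwa [MonoidHom.comap_bot, QuotientGroup.ker_mk', Subgroup.comap_top] at this
  exact h.mono hL _ _ (key hr) (key hs)

theorem primeStepsAbove_of_quotient {N : Subgroup G} [N.Normal]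
    (h : PrimeStepsAbove (⊥ : Subgroup (G ⧸ N))) : PrimeStepsAbove N := by
  intro A B hA hAB
  have hker : (QuotientGroup.mk' N).ker = N := QuotientGroup.ker_mk' N
  have hAA : (A.map (QuotientGroup.mk' N)).comap (QuotientGroup.mk' N) = A :=
    Subgroup.comap_map_eq_self (by rwa [hker])
  have hBB : (B.map (QuotientGroup.mk' N)).comap (QuotientGroup.mk' N) = B :=
    Subgroup.comap_map_eq_self (by rw [hker]; exact hA.trans hAB.le)
  have hc : A.map (QuotientGroup.mk' N) ⋖ B.map (QuotientGroup.mk' N) := by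
    refine ⟨lt_of_le_of_ne (Subgroup.map_mono hAB.le) fun he => ?_, fun C h1 h2 => ?_⟩
    · exact hAB.lt.ne (by rw [← hAA, he, hBB])
    · refine hAB.2 (c := C.comap (QuotientGroup.mk' N)) ?_ ?_
      · rw [← hAA]
        exact (Subgroup.comap_lt_comap_of_surjective (QuotientGroup.mk'_surjective N)).2 h1
      · rw [← hBB]
        exact (Subgroup.comap_lt_comap_of_surjective (QuotientGroup.mk'_surjective N)).2 h2
  have := h _ _ bot_le hc
  rwa [← hAA, ← hBB, Subgroup.relIndex_comap,
    Subgroup.map_comap_eq_self_of_surjective (QuotientGroup.mk'_surjective N)]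

theorem PrimeStepsAbove.quotient {N : Subgroup G} [N.Normal]
    (h : PrimeStepsAbove N) : PrimeStepsAbove (⊥ : Subgroup (G ⧸ N)) := by
  intro A B _ hAB
  have h1 : CoverChain A B 1 := .single hAB
  have h2 : A.comap (QuotientGroup.mk' N) ⋖ B.comap (QuotientGroup.mk' N) := h1.comap_mk'.covBy
  have := h _ _ (by simpa using Subgroup.ker_le_comap (QuotientGroup.mk' N) A) h2
  rwa [Subgroup.relIndex_comap,
    Subgroup.map_comap_eq_self_of_surjective (QuotientGroup.mk'_surjective N)] at this

/-- All chains of covers from a given subgroup of prime order to the whole group have the same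
length. -/
def UniformAtPrimes (G : Type*) [Group G] : Prop :=
  ∀ H : Subgroup G, (Nat.card H).Prime → UniformAbove H

theorem UniformAtPrimes.of_bot [Finite G] (h : UniformAbove (⊥ : Subgroup G)) :
    UniformAtPrimes G := fun _ _ => h.mono bot_le

theorem Subgroup.card_map_subtype {X : Subgroup G} (A : Subgroup X) :
    Nat.card (A.map X.subtype) = Nat.card A :=
  Nat.card_congr (A.equivMapOfInjective _ X.subtype_injective).symm.toEquiv

theorem UniformAtPrimes.subgroup [Finite G] (h : UniformAtPrimes G) (X : Subgroup G) :
    UniformAtPrimes X := by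
  intro H hH r s hr hs
  obtain ⟨m, hm⟩ := CoverChain.exists_of_le (le_top (a := X))
  exact Nat.add_right_cancel (h (H.map X.subtype) (by rwa [Subgroup.card_map_subtype]) _ _
    (hr.map_subtype_top hm) (hs.map_subtype_top hm))

theorem Subgroup.exists_le_card_eq_prime [Finite G] {p : ℕ} (hp : p.Prime) {H : Subgroup G}
    (h : p ∣ Nat.card H) : ∃ P ≤ H, Nat.card P = p := by
  have := Fact.mk hp
  obtain ⟨x, hx⟩ := exists_prime_orderOf_dvd_card' p h
  refine ⟨Subgroup.zpowers (x : G), by simp, ?_⟩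
  rw [Nat.card_zpowers, Subgroup.orderOf_coe, hx]

theorem IsPGroup.dvd_card_of_ne_bot [Finite G] {p : ℕ} [Fact p.Prime] {H : Subgroup G}
    (h : IsPGroup p H) (hne : H ≠ ⊥) : p ∣ Nat.card H := by
  obtain ⟨n, hn⟩ := IsPGroup.iff_card.1 h
  rw [hn]
  refine dvd_pow_self p fun h0 => hne ?_
  rw [h0, pow_zero] at hn
  exact Subgroup.card_eq_one.1 hn

theorem UniformAtPrimes.quotient_bot [Finite G] (h : UniformAtPrimes G) {N : Subgroup G}
    [N.Normal] (hne : N ≠ ⊥) : UniformAbove (⊥ : Subgroup (G ⧸ N)) := by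
  have h1 : Nat.card N ≠ 1 := fun h1 => hne (Subgroup.card_eq_one.1 h1)
  obtain ⟨P, hPN, hP⟩ := Subgroup.exists_le_card_eq_prime (Nat.minFac_prime h1)
    (Nat.minFac_dvd (Nat.card N))
  exact (h P (hP ▸ Nat.minFac_prime h1)).quotient_bot hPN

end Transfer

section Conjugation

open ArithmeticFunction

open scoped ArithmeticFunction.Omega

variable {G : Type*} [Group G] [Finite G]

theorem IsPGroup.length_eq {p : ℕ} [Fact p.Prime] {A B : Subgroup G} {n : ℕ}
    (hB : IsPGroup p B) (h : CoverChain A B n) : n = Ω (A.relIndex B) := by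
  induction h with
  | refl => simp
  | cons h h' ih =>
    rw [cardFactors_relIndex_add h.le h'.le,
      cardFactors_eq_one_iff_prime.2 ((hB.to_le h'.le).prime_relIndex_of_covBy h),
      ← ih hB, add_comm]

theorem Subgroup.relIndex_eq_of_card_eq {A A' B : Subgroup G} (hA : A ≤ B) (hA' : A' ≤ B)
    (h : Nat.card A = Nat.card A') : A.relIndex B = A'.relIndex B := by
  have h1 := Subgroup.card_mul_relIndex_of_le hA
  rw [← Subgroup.card_mul_relIndex_of_le hA', h] at h1
  exact Nat.eq_of_mul_eq_mul_left Nat.card_pos h1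

theorem UniformAtPrimes.length_eq (hG : UniformAtPrimes G) {q : ℕ} (hq : q.Prime)
    {Q Q' : Subgroup G} (hQ : Nat.card Q = q) (hQ' : Nat.card Q' = q) {m n : ℕ}
    (hm : CoverChain Q ⊤ m) (hn : CoverChain Q' ⊤ n) : m = n := by
  have := Fact.mk hq
  have hpQ : IsPGroup q Q := IsPGroup.of_card (n := 1) (by rw [hQ, pow_one])
  have hpQ' : IsPGroup q Q' := IsPGroup.of_card (n := 1) (by rw [hQ', pow_one])
  obtain ⟨S, hS⟩ := hpQ.exists_le_sylow
  obtain ⟨T, hT⟩ := hpQ'.exists_le_sylow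
  obtain ⟨g, hg⟩ := MulAction.exists_smul_eq G T S
  have hn' := hn.map_equiv (MulAut.conj g)
  rw [Subgroup.map_top_of_surjective _ (MulAut.conj g).surjective] at hn'
  have hc : Nat.card (Q'.map (MulAut.conj g).toMonoidHom) = q := by
    rw [← hQ']
    exact Nat.card_congr (Q'.equivMapOfInjective _ (MulAut.conj g).injective).symm.toEquiv
  have hle : Q'.map (MulAut.conj g).toMonoidHom ≤ S := by
    rw [← hg]
    exact Subgroup.map_mono hT
  obtain ⟨a, ha⟩ := CoverChain.exists_of_le hS
  obtain ⟨b, hb⟩ := CoverChain.exists_of_le hle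
  obtain ⟨c, hcS⟩ := CoverChain.exists_of_le (le_top (a := (S : Subgroup G)))
  have e1 := hG Q (hQ ▸ hq) _ _ hm (ha.trans hcS)
  have e2 := hG _ (hc.symm ▸ hq) _ _ hn' (hb.trans hcS)
  rw [e1, e2, S.isPGroup'.length_eq ha, S.isPGroup'.length_eq hb,
    Subgroup.relIndex_eq_of_card_eq hS hle (hQ.trans hc.symm)]

theorem UniformAtPrimes.primeStepsAbove_of_card_eq (hG : UniformAtPrimes G) {q : ℕ}
    (hq : q.Prime) {Q Q' : Subgroup G} (hQ : Nat.card Q = q) (hQ' : Nat.card Q' = q)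
    (h : PrimeStepsAbove Q) : PrimeStepsAbove Q' := by
  obtain ⟨m, hm⟩ := CoverChain.exists_of_le (le_top (a := Q))
  obtain ⟨n, hn⟩ := CoverChain.exists_of_le (le_top (a := Q'))
  have h1 := hG.length_eq hq hQ hQ' hm hn
  refine (hG Q' (hQ' ▸ hq)).primeStepsAbove ?_
  rw [← Subgroup.relIndex_top_right,
    ← Subgroup.relIndex_eq_of_card_eq le_top le_top (hQ.trans hQ'.symm), ← h.length_eq hm le_rfl,
    h1]
  exact hn

end Conjugation

section NormalSubgroups

variable {G : Type*} [Group G]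

theorem Subgroup.relIndex_sup_of_le_normalizer [Finite G] {H K : Subgroup G}
    (h : H ≤ Subgroup.normalizer (K : Set G)) : H.relIndex (H ⊔ K) = H.relIndex K := by
  obtain ⟨W, hW⟩ : ∃ W, W = H ⊔ K := ⟨_, rfl⟩
  have hHW : H ≤ W := hW ▸ le_sup_left
  have hKW : K ≤ W := hW ▸ le_sup_right
  have : (K.subgroupOf W).Normal := by
    rw [hW]
    exact Subgroup.normal_subgroupOf_sup_of_le_normalizer h
  have h1 : K.relIndex W = K.relIndex H := by
    have h0 : H.subgroupOf W ⊔ K.subgroupOf W = ⊤ := by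
      rw [← Subgroup.subgroupOf_sup hHW hKW, ← hW, Subgroup.subgroupOf_self]
    have := Subgroup.relIndex_sup_right (H.subgroupOf W) (K.subgroupOf W)
    rw [h0, Subgroup.relIndex_top_right] at this
    exact this.trans (Subgroup.relIndex_subgroupOf hHW)
  rw [← hW]
  have h2 := Subgroup.card_mul_relIndex_of_le hHW
  have h3 := Subgroup.card_mul_relIndex_of_le hKW
  have h4 := Subgroup.card_mul_relIndex_of_le (inf_le_left : H ⊓ K ≤ H)
  have h5 := Subgroup.card_mul_relIndex_of_le (inf_le_right : H ⊓ K ≤ K)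
  rw [Subgroup.inf_relIndex_right] at h5
  rw [Subgroup.inf_relIndex_left] at h4
  rw [h1, ← h2, ← h5] at h3
  refine Nat.eq_of_mul_eq_mul_left (Nat.card_pos (α := H)) ?_
  rw [← h3, ← h4]
  ring

/-- If the steps above `V` have prime index, then every normal subgroup `N` not contained in `V`
contains a `V`-invariant subgroup which is one prime step above `V ⊓ N`. -/
theorem PrimeStepsAbove.exists_le_normalizer [Finite G] {V N : Subgroup G} [N.Normal]
    (hV : PrimeStepsAbove V) (hN : ¬ N ≤ V) :
    ∃ E ≤ N, V ⊓ N ≤ E ∧ V ≤ Subgroup.normalizer (E : Set G) ∧ ((V ⊓ N).relIndex E).Prime := by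
  obtain ⟨Z, hVZ, hZ⟩ := exists_covBy_le_of_lt (left_lt_sup.2 hN)
  have hnorm : V ≤ Subgroup.normalizer ((Z ⊓ N : Subgroup G) : Set G) := by
    rw [Subgroup.le_normalizer_iff]
    rintro v hv x ⟨hxZ, hxN⟩
    exact ⟨Z.mul_mem (Z.mul_mem (hVZ.le hv) hxZ) (Z.inv_mem (hVZ.le hv)),
      Subgroup.Normal.conj_mem ‹_› x hxN v⟩
  refine ⟨Z ⊓ N, inf_le_right, inf_le_inf_right N hVZ.le, hnorm, ?_⟩
  have hsup : V ⊔ (Z ⊓ N) = Z := by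
    refine le_antisymm (sup_le hVZ.le inf_le_left) fun z hz => ?_
    obtain ⟨v, hv, n, hn, rfl⟩ := Subgroup.mem_sup_of_normal_right.1 (hZ hz)
    refine Subgroup.mul_mem_sup hv ⟨?_, hn⟩
    have := Z.mul_mem (Z.inv_mem (hVZ.le hv)) hz
    rwa [inv_mul_cancel_left] at this
  have h := hV V Z le_rfl hVZ
  rw [← hsup, Subgroup.relIndex_sup_of_le_normalizer hnorm, ← Subgroup.inf_relIndex_right] at h
  rwa [← inf_assoc, inf_eq_left.2 hVZ.le] at h

theorem PrimeStepsAbove.exists_card_eq_le_normalizer [Finite G] {p : ℕ} [hp : Fact p.Prime]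
    {V A : Subgroup G} [A.Normal] (hV : PrimeStepsAbove V) (hA : IsPGroup p A) (hne : A ≠ ⊥)
    (hdisj : V ⊓ A = ⊥) :
    ∃ E ≤ A, Nat.card E = p ∧ V ≤ Subgroup.normalizer (E : Set G) := by
  obtain ⟨E, hEA, -, hEn, hE⟩ := hV.exists_le_normalizer (N := A) fun h => hne (by
    rwa [inf_eq_right.2 h] at hdisj)
  rw [hdisj, Subgroup.relIndex_bot_left] at hE
  refine ⟨E, hEA, ?_, hEn⟩
  have h1 := (hA.to_le hEA).dvd_card_of_ne_bot (fun h => by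
    rw [h, Subgroup.card_bot] at hE
    exact Nat.not_prime_one hE)
  exact ((Nat.prime_dvd_prime_iff_eq hp.out hE).1 h1).symm

theorem Subgroup.inf_eq_bot_of_coprime' {H K : Subgroup G}
    (h : (Nat.card H).Coprime (Nat.card K)) : H ⊓ K = ⊥ :=
  Subgroup.card_eq_one.1 (Nat.eq_one_of_dvd_coprimes h (Subgroup.card_dvd_of_le inf_le_left)
    (Subgroup.card_dvd_of_le inf_le_right))

theorem UniformAtPrimes.primeStepsAbove_of_le_normalizer [Finite G] (hG : UniformAtPrimes G)
    {p q : ℕ} (hp : p.Prime) (hq : q.Prime) (hpq : p ≠ q) {P E Q : Subgroup G}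
    (hP : Nat.card P = p) (hgood : PrimeStepsAbove P) (hE : Nat.card E = p) (hQ : Nat.card Q = q)
    (hQE : Q ≤ Subgroup.normalizer (E : Set G)) : PrimeStepsAbove Q := by
  have hEgood := hG.primeStepsAbove_of_card_eq hp hP hE hgood
  refine (hG Q (hQ ▸ hq)).primeStepsAbove_of_prime (K := Q ⊔ E) le_sup_left ?_
    (hEgood.mono le_sup_right)
  rw [Subgroup.relIndex_sup_of_le_normalizer hQE, ← Subgroup.inf_relIndex_right,
    Subgroup.inf_eq_bot_of_coprime', Subgroup.relIndex_bot_left, hE]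
  · exact hp
  · rw [hE, hQ]
    exact ((Nat.coprime_primes hp hq).2 hpq).symm

theorem Subgroup.not_dvd_card_sup [Finite G] {p : ℕ} (hp : p.Prime) {H K : Subgroup G}
    (h : H ≤ Subgroup.normalizer (K : Set G)) (hH : ¬ p ∣ Nat.card H) (hK : ¬ p ∣ Nat.card K) :
    ¬ p ∣ Nat.card (H ⊔ K : Subgroup G) := by
  rw [← Subgroup.card_mul_relIndex_of_le (le_sup_left : H ≤ H ⊔ K),
    Subgroup.relIndex_sup_of_le_normalizer h, hp.dvd_mul]
  rintro (h | h)
  exacts [hH h, hK (h.trans (Subgroup.relIndex_dvd_card _ _))]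

theorem IsPGroup.coprime_card_of_not_dvd [Finite G] {p n : ℕ} [hp : Fact p.Prime] {A : Subgroup G}
    (hA : IsPGroup p A) (h : ¬ p ∣ n) : n.Coprime (Nat.card A) := by
  obtain ⟨m, hm⟩ := IsPGroup.iff_card.1 hA
  rw [hm]
  exact (((Nat.Prime.coprime_iff_not_dvd hp.out).2 h).symm).pow_right m

/-- Above a normal `r`-subgroup with prime steps, an `r'`-complemented subgroup of order prime
to `p` normalizes a subgroup of order `p` in every nontrivial normal `p`-subgroup. -/
theorem PrimeStepsAbove.exists_le_normalizer_of_normal [Finite G] {p r : ℕ} [hp : Fact p.Prime]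
    [hr : Fact r.Prime] (hpr : p ≠ r) {R A Q : Subgroup G} [R.Normal] [A.Normal]
    (hR : IsPGroup r R) (hRgood : PrimeStepsAbove R) (hA : IsPGroup p A) (hne : A ≠ ⊥)
    (hQ : ¬ p ∣ Nat.card Q) :
    ∃ E ≤ A, Nat.card E = p ∧ Q ≤ Subgroup.normalizer (E : Set G) := by
  have hnR : ¬ p ∣ Nat.card R := by
    obtain ⟨n, hn⟩ := IsPGroup.iff_card.1 hR
    rw [hn]
    exact fun h => hpr ((Nat.prime_dvd_prime_iff_eq hp.out hr.out).1 (hp.out.dvd_of_dvd_pow h))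
  obtain ⟨E, hEA, hE, hn⟩ := (hRgood.mono (le_sup_right : R ≤ Q ⊔ R)).exists_card_eq_le_normalizer
    hA hne (Subgroup.inf_eq_bot_of_coprime' (hA.coprime_card_of_not_dvd
      (Subgroup.not_dvd_card_sup hp.out (by rw [Subgroup.normalizer_eq_top]; exact le_top)
        hQ hnR)))
  exact ⟨E, hEA, hE, le_sup_left.trans hn⟩

/-- If all maximal subgroups have prime index, the Sylow subgroup for the largest prime divisor
of the group order is normal. -/
theorem Sylow.normal_of_forall_prime_index [Finite G]
    (hG : ∀ M : Subgroup G, IsCoatom M → M.index.Prime) {r : ℕ} [hr : Fact r.Prime]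
    (hmax : ∀ q, q.Prime → q ∣ Nat.card G → q ≤ r) (R : Sylow r G) :
    (R : Subgroup G).Normal := by
  rw [← Subgroup.normalizer_eq_top_iff]
  obtain h | ⟨M, hM, hRM⟩ := eq_top_or_exists_le_coatom (Subgroup.normalizer (R : Set G))
  · exact h
  exfalso
  have hle : (R : Subgroup G) ≤ M := Subgroup.le_normalizer.trans hRM
  have hlt : M.index < r := by
    refine lt_of_le_of_ne (hmax _ (hG M hM) M.index_dvd_card) fun h => R.not_dvd_index ?_
    exact (dvd_of_eq h.symm).trans (Subgroup.index_dvd_of_le hle)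
  have hfix : ∀ (g : R) (x : G ⧸ M), g • x = x := by
    intro g x
    obtain ⟨n, hn⟩ := R.isPGroup'.card_orbit x
    have h1 : Nat.card (MulAction.orbit R x) ≤ M.index := Nat.card_le_card_of_injective _
      (Subtype.val_injective (p := fun y => y ∈ MulAction.orbit R x))
    have h2 : n = 0 := by
      by_contra h0
      exact (hn ▸ h1.trans_lt hlt).not_ge (Nat.le_self_pow h0 r)
    rw [h2, pow_zero, Nat.card_eq_one_iff_unique] at hn
    have := hn.1.elim ⟨g • x, MulAction.mem_orbit x g⟩ ⟨x, MulAction.mem_orbit_self x⟩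
    exact congrArg Subtype.val this
  have hcore : (R : Subgroup G) ≤ M.normalCore := by
    intro g hg b
    have := hfix ⟨g, hg⟩ ((b⁻¹ : G) : G ⧸ M)
    have h3 : ((g * b⁻¹ : G) : G ⧸ M) = ((b⁻¹ : G) : G ⧸ M) := this
    have h4 := QuotientGroup.eq.1 h3.symm
    simpa [mul_assoc] using h4
  have := R.normalizer_sup_eq_top' hcore
  exact hM.1 (top_le_iff.1 (this ▸ sup_le hRM M.normalCore_le))

end NormalSubgroups

section Fusion

open scoped commutatorElement Pointwise

variable {G : Type*} [Group G] {q : ℕ}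

/-- Elements of prime power order, for primes different from `q`, which normalize a nontrivial
`q`-subgroup centralize it. -/
def CentralizesLocally (G : Type*) [Group G] (q : ℕ) : Prop :=
  ∀ H : Subgroup G, IsPGroup q H → H ≠ ⊥ → ∀ y ∈ Subgroup.normalizer (H : Set G),
    ∀ s : ℕ, s.Prime → s ≠ q → (∃ k, orderOf y = s ^ k) → y ∈ Subgroup.centralizer (H : Set G)

theorem Sylow.conj_mem_smul_iff {S : Sylow q G} {g x : G} : g * x * g⁻¹ ∈ g • S ↔ x ∈ S := by
  change MulAut.conj g • x ∈ MulAut.conj g • (S : Subgroup G) ↔ x ∈ (S : Subgroup G)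
  exact Subgroup.smul_mem_pointwise_smul_iff

variable [Finite G] [hq : Fact q.Prime]

theorem CentralizesLocally.exists_mul_eq (h : CentralizesLocally G q) {H : Subgroup G}
    (hH : IsPGroup q H) (hne : H ≠ ⊥) (S : Sylow q (Subgroup.normalizer (H : Set G)))
    (n : Subgroup.normalizer (H : Set G)) :
    ∃ c t : Subgroup.normalizer (H : Set G), (c : G) ∈ Subgroup.centralizer (H : Set G) ∧
      t ∈ S ∧ c * t = n := by
  set C := (Subgroup.centralizer (H : Set G)).subgroupOf (Subgroup.normalizer (H : Set G)) with hC
  have hCn : C.Normal := by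
    rw [hC, ← Subgroup.normalizerMonoidHom_ker]
    infer_instance
  have htop : C ⊔ S = ⊤ := by
    rw [← Subgroup.index_eq_one]
    by_contra hne1
    have hs := Nat.minFac_prime hne1
    have hdvd := Nat.minFac_dvd (C ⊔ S).index
    set s := (C ⊔ S).index.minFac
    have := Fact.mk hs
    by_cases hsq : s = q
    · have hdvd' := hdvd.trans (Subgroup.index_dvd_of_le (le_sup_right : (S : Subgroup _) ≤ C ⊔ S))
      exact S.not_dvd_index ((dvd_of_eq hsq.symm).trans hdvd')
    · obtain ⟨T⟩ : Nonempty (Sylow s (Subgroup.normalizer (H : Set G))) := inferInstance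
      refine T.not_dvd_index (hdvd.trans (Subgroup.index_dvd_of_le (le_trans ?_ le_sup_left)))
      intro y hy
      obtain ⟨k, hk⟩ := IsPGroup.iff_orderOf.1 T.isPGroup' ⟨y, hy⟩
      rw [Subgroup.orderOf_mk] at hk
      exact h H hH hne y y.2 s hs hsq ⟨k, by rw [Subgroup.orderOf_coe, hk]⟩
  obtain ⟨c, hc, t, ht, hct⟩ := Subgroup.mem_sup_of_normal_left.1 (htop ▸ Subgroup.mem_top n)
  exact ⟨c, t, hc, ht, hct⟩

theorem CentralizesLocally.exists_smul_eq_of_normalizer (h : CentralizesLocally G q)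
    {H : Subgroup G} (hH : IsPGroup q H) (hne : H ≠ ⊥)
    (S T : Sylow q (Subgroup.normalizer (H : Set G))) :
    ∃ c : Subgroup.normalizer (H : Set G), (c : G) ∈ Subgroup.centralizer (H : Set G) ∧
      c • S = T := by
  obtain ⟨n, hn⟩ := MulAction.exists_smul_eq (Subgroup.normalizer (H : Set G)) S T
  obtain ⟨c, t, hc, ht, rfl⟩ := h.exists_mul_eq hH hne S n
  refine ⟨c, hc, ?_⟩
  rw [← hn, mul_smul, Sylow.smul_eq_iff_mem_normalizer.2 (Subgroup.le_normalizer ht)]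

theorem Sylow.exists_mem_normalizer_inf {S T : Sylow q G} (hST : S ≠ T) :
    ∃ x ∈ S, x ∉ T ∧ x ∈ Subgroup.normalizer ((S ⊓ T : Subgroup G) : Set G) := by
  have hS : Group.IsNilpotent S := S.isPGroup'.isNilpotent
  have hlt : ((S ⊓ T : Subgroup G).subgroupOf S) < ⊤ := by
    rw [lt_top_iff_ne_top, Ne, Subgroup.subgroupOf_eq_top]
    intro hle
    exact hST (Sylow.ext (S.is_maximal' T.isPGroup' (hle.trans inf_le_right)).symm)
  obtain ⟨x, hx, hx'⟩ := SetLike.exists_of_lt (Group.normalizerCondition_of_isNilpotent _ hlt)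
  rw [← Subgroup.subgroupOf_normalizer_eq inf_le_left] at hx
  exact ⟨x, x.2, fun hxT => hx' ⟨x.2, hxT⟩, hx⟩

theorem CentralizesLocally.exists_smul_eq (h : CentralizesLocally G q) (S T : Sylow q G) :
    ∃ c ∈ Subgroup.centralizer ((S ⊓ T : Subgroup G) : Set G), c • S = T := by
  induction hn : Nat.card G - Nat.card (S ⊓ T : Subgroup G) using Nat.strong_induction_on
    generalizing S T with
  | _ n ih =>
  obtain rfl | hST := eq_or_ne S T
  · exact ⟨1, one_mem _, one_smul _ _⟩
  obtain hD | hD := eq_or_ne (S ⊓ T : Subgroup G) ⊥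
  · obtain ⟨g, hg⟩ := MulAction.exists_smul_eq G S T
    refine ⟨g, ?_, hg⟩
    rw [hD, Subgroup.mem_centralizer_iff]
    simp
  set D : Subgroup G := S ⊓ T with hDdef
  set N := Subgroup.normalizer (D : Set G) with hN
  have step : ∀ S' T' : Sylow q G, D < (S' : Subgroup G) ⊓ T' →
      ∃ c ∈ Subgroup.centralizer (D : Set G), c • S' = T' := by
    intro S' T' hlt
    have hcard : Nat.card D < Nat.card (S' ⊓ T' : Subgroup G) := by
      refine lt_of_le_of_ne (Subgroup.card_le_of_le hlt.le) fun he => ?_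
      exact hlt.ne (Subgroup.eq_of_le_of_card_ge hlt.le he.ge)
    have hcard' := Subgroup.card_le_card_group (S' ⊓ T' : Subgroup G)
    obtain ⟨c, hc, hcS⟩ := ih _ (by omega) S' T' rfl
    exact ⟨c, Subgroup.centralizer_le hlt.le hc, hcS⟩
  have ext : ∀ S' : Sylow q G, ∃ S₁ : Sylow q N, S'.subgroupOf N ≤ S₁ := fun S' =>
    (S'.isPGroup'.comap_of_injective N.subtype N.subtype_injective).exists_le_sylow
  obtain ⟨S₁, hS₁⟩ := ext S
  obtain ⟨T₁, hT₁⟩ := ext T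
  obtain ⟨c₂, hc₂, hc₂S⟩ := h.exists_smul_eq_of_normalizer
    (S.isPGroup'.to_le inf_le_left) hD S₁ T₁
  obtain ⟨S₂, hS₂⟩ := (S₁.isPGroup'.map N.subtype).exists_le_sylow
  have hSS₂ : D < (S : Subgroup G) ⊓ S₂ := by
    have hsub : ∀ x ∈ S, x ∈ N → x ∈ S₂ := fun x hx hxN =>
      hS₂ ⟨⟨x, hxN⟩, hS₁ hx, rfl⟩
    obtain ⟨x, hxS, hxT, hxN⟩ := Sylow.exists_mem_normalizer_inf hST
    refine lt_of_le_of_ne (le_inf inf_le_left fun y hy =>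
      hsub y hy.1 (Subgroup.le_normalizer hy)) fun he => hxT ?_
    have : x ∈ (S ⊓ S₂ : Subgroup G) := ⟨hxS, hsub x hxS hxN⟩
    rw [← he] at this
    exact this.2
  have hTT₂ : D < (((c₂ : G) • S₂ : Sylow q G) : Subgroup G) ⊓ T := by
    have hsub : ∀ x ∈ T, x ∈ N → x ∈ (c₂ : G) • S₂ := by
      intro x hx hxN
      have hx1 : (⟨x, hxN⟩ : N) ∈ c₂ • S₁ := hc₂S ▸ hT₁ hx
      have e : (⟨x, hxN⟩ : N) = c₂ * (c₂⁻¹ * ⟨x, hxN⟩ * c₂) * c₂⁻¹ := by group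
      rw [e, Sylow.conj_mem_smul_iff] at hx1
      have hx2 : (c₂ : G)⁻¹ * x * c₂ ∈ S₂ := hS₂ ⟨_, hx1, rfl⟩
      have e' : x = (c₂ : G) * ((c₂ : G)⁻¹ * x * c₂) * (c₂ : G)⁻¹ := by group
      rwa [e', Sylow.conj_mem_smul_iff]
    obtain ⟨x, hxT, hxS, hxN⟩ := Sylow.exists_mem_normalizer_inf hST.symm
    rw [inf_comm, ← hDdef] at hxN
    refine lt_of_le_of_ne (le_inf (fun y hy =>
      hsub y hy.2 (Subgroup.le_normalizer hy)) inf_le_right) fun he => hxS ?_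
    have : x ∈ (((c₂ : G) • S₂ : Sylow q G) ⊓ T : Subgroup G) := ⟨hsub x hxT hxN, hxT⟩
    rw [← he] at this
    exact this.1
  obtain ⟨c₁, hc₁, hc₁S⟩ := step S S₂ hSS₂
  obtain ⟨c₃, hc₃, hc₃S⟩ := step _ T hTT₂
  exact ⟨c₃ * (c₂ * c₁), mul_mem hc₃ (mul_mem hc₂ hc₁), by
    rw [mul_smul, mul_smul, hc₁S, hc₃S]⟩

theorem CentralizesLocally.exists_conj_eq (h : CentralizesLocally G q) {S : Sylow q G}
    (hS : (S : Subgroup G) ≠ ⊥) {x g : G} (hx : x ∈ S) (hxg : g * x * g⁻¹ ∈ S) :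
    ∃ t ∈ S, g * x * g⁻¹ = t * x * t⁻¹ := by
  obtain ⟨c, hc, hcS⟩ := h.exists_smul_eq (g • S) S
  rw [← mul_smul, Sylow.smul_eq_iff_mem_normalizer] at hcS
  obtain ⟨d, t, hd, ht, hdt⟩ := h.exists_mul_eq S.isPGroup' hS
    (S.subtype Subgroup.le_normalizer) ⟨c * g, hcS⟩
  have ht' : (t : G) ∈ S := ht
  have hdt' : (d : G) * t = c * g := congrArg Subtype.val hdt
  refine ⟨t, ht', ?_⟩
  have h1 := Subgroup.mem_centralizer_iff.1 hc (g * x * g⁻¹)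
    ⟨Sylow.conj_mem_smul_iff.2 hx, hxg⟩
  have h2 := Subgroup.mem_centralizer_iff.1 hd ((t : G) * x * (t : G)⁻¹)
    (mul_mem (mul_mem ht' hx) (inv_mem ht'))
  calc g * x * g⁻¹ = c * (g * x * g⁻¹) * c⁻¹ := by rw [← h1]; group
    _ = (c * g) * x * (c * g)⁻¹ := by group
    _ = d * (t * x * (t : G)⁻¹) * (d : G)⁻¹ := by rw [← hdt']; group
    _ = t * x * (t : G)⁻¹ := by rw [← h2]; group

/-- A form of Frobenius' normal `p`-complement theorem. -/
theorem CentralizesLocally.commutator_ne_top (h : CentralizesLocally G q)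
    (hdvd : q ∣ Nat.card G) : commutator G ≠ ⊤ := by
  intro htop
  obtain ⟨S⟩ : Nonempty (Sylow q G) := inferInstance
  have hS : (S : Subgroup G) ≠ ⊥ := S.ne_bot_of_dvd_card hdvd
  have hle : (S : Subgroup G) ≤ ⁅(S : Subgroup G), (S : Subgroup G)⁆ := by
    have h1 := Subgroup.commutator_inf_eq_focalSubgroup S
    rw [htop, top_inf_eq] at h1
    nth_rewrite 1 [h1]
    refine (Subgroup.closure_le _).2 ?_
    rintro _ ⟨hxu, x, hx, u, rfl⟩
    have h2 : u * x⁻¹ * u⁻¹ ∈ S := by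
      change _ ∈ (S : Subgroup G)
      have := S.mul_mem (S.inv_mem hx) hxu
      simpa [commutatorElement_def, mul_assoc] using this
    obtain ⟨t, ht, hut⟩ := h.exists_conj_eq hS (inv_mem hx) h2
    have : ⁅x, u⁆ = ⁅x, t⁆ := by
      rw [commutatorElement_def, commutatorElement_def, mul_assoc x, mul_assoc x, mul_assoc x,
        mul_assoc x, hut]
    rw [this]
    exact Subgroup.commutator_mem_commutator hx ht
  have : Group.IsNilpotent S := S.isPGroup'.isNilpotent
  have : Nontrivial S := (Subgroup.nontrivial_iff_ne_bot _).2 hS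
  refine (Group.IsSolvable.commutator_lt_top_of_nontrivial S).not_ge ?_
  rw [← Subgroup.map_subtype_le_map_subtype, ← MonoidHom.range_eq_map, Subgroup.range_subtype]
  refine hle.trans (le_of_eq ?_)
  rw [commutator_def, Subgroup.map_commutator, ← MonoidHom.range_eq_map, Subgroup.range_subtype]

end Fusion

section Eigenvector

open Polynomial

theorem FiniteField.prod_X_sub_C (K : Type*) [Field K] [Fintype K] :
    ∏ a : K, (X - C a) = (X ^ Fintype.card K - X : K[X]) := by
  have hdeg := FiniteField.X_pow_card_sub_X_natDegree_eq K (Fintype.one_lt_card (α := K))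
  rw [← prod_multiset_X_sub_C_of_monic_of_roots_card_eq
    (monic_X_pow_sub (by simpa using Fintype.one_lt_card (α := K)))
    (by rw [FiniteField.roots_X_pow_card_sub_X, hdeg]; rfl),
    FiniteField.roots_X_pow_card_sub_X]
  rfl

theorem Module.End.exists_hasEigenvector_of_pow_card_eq {K V : Type*} [Field K] [Finite K]
    [AddCommGroup V] [Module K V] [Nontrivial V] {T : Module.End K V}
    (hf : ∀ v, T^[Nat.card K] v = T v) : ∃ (a : K) (v : V), T.HasEigenvector a v := by
  have := Fintype.ofFinite K
  have hT : T ^ Nat.card K = T := LinearMap.ext fun v => by rw [Module.End.pow_apply, hf]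
  by_contra! h
  have hinj : ∀ s : Finset K, Function.Injective (aeval T (∏ a ∈ s, (X - C a))) := by
    classical
    intro s
    induction s using Finset.induction_on with
    | empty => exact fun x y hxy => by simpa using hxy
    | insert a s has ih =>
      rw [Finset.prod_insert has, map_mul, Module.End.mul_eq_comp, LinearMap.coe_comp]
      refine Function.Injective.comp ?_ ih
      rw [← LinearMap.ker_eq_bot, LinearMap.ker_eq_bot']
      intro v hv
      by_contra hv0
      refine h a v ⟨?_, hv0⟩
      rw [Module.End.mem_eigenspace_iff]
      simpa [sub_eq_zero] using hv
  have h0 := hinj Finset.univ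
  rw [FiniteField.prod_X_sub_C, ← Nat.card_eq_fintype_card] at h0
  obtain ⟨v, hv⟩ := exists_ne (0 : V)
  exact hv (h0 (by
    rw [map_sub, map_pow, aeval_X, hT, sub_self, LinearMap.zero_apply, LinearMap.zero_apply]))

theorem AddMonoidHom.exists_eq_nsmul_of_iterate_eq {p : ℕ} [hp : Fact p.Prime] {V : Type*}
    [AddCommGroup V] [Nontrivial V] (hV : ∀ v : V, p • v = 0) (f : V →+ V)
    (hf : ∀ v, f^[p] v = f v) : ∃ v ≠ 0, ∃ k : ℕ, f v = k • v := by
  let _ : Module (ZMod p) V := AddCommGroup.zmodModule hV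
  let T : Module.End (ZMod p) V := f.toZModLinearMap p
  obtain ⟨k, v, hv⟩ := Module.End.exists_hasEigenvector_of_pow_card_eq (T := T)
    (by rw [Nat.card_zmod]; exact hf)
  refine ⟨v, hv.2, k.val, ?_⟩
  have h1 := hv.apply_eq_smul
  rwa [← ZMod.natCast_zmod_val k, Nat.cast_smul_eq_nsmul] at h1

theorem Subgroup.exists_conj_eq_pow {G : Type*} [Group G] {p : ℕ} [hp : Fact p.Prime]
    {A : Subgroup G} (hcomm : ∀ a ∈ A, ∀ b ∈ A, a * b = b * a) (hexp : ∀ a ∈ A, a ^ p = 1)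
    (hne : A ≠ ⊥) {y : G} (hy : ∀ a ∈ A, y * a * y⁻¹ ∈ A) (hyp : y ^ p = y) :
    ∃ v ∈ A, v ≠ 1 ∧ ∃ k : ℕ, y * v * y⁻¹ = v ^ k := by
  let _ : CommGroup A :=
    { (inferInstance : Group A) with
      mul_comm := fun a b => Subtype.ext (hcomm a a.2 b b.2) }
  let f : A →* A := MonoidHom.mk' (fun a => ⟨y * a * y⁻¹, hy a a.2⟩) fun a b =>
    Subtype.ext (by simp)
  have hpow : ∀ (n : ℕ) (a : A), (f^[n] a : G) = y ^ n * a * (y ^ n)⁻¹ := by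
    intro n a
    induction n with
    | zero => simp
    | succ n ih =>
      rw [Function.iterate_succ_apply']
      change y * (f^[n] a : G) * y⁻¹ = _
      rw [ih, pow_succ']
      group
  have : Nontrivial A := (Subgroup.nontrivial_iff_ne_bot _).2 hne
  obtain ⟨v, hv, k, hk⟩ := AddMonoidHom.exists_eq_nsmul_of_iterate_eq (p := p)
    (V := Additive A) (fun v => congrArg Additive.ofMul
      (Subtype.ext (hexp v.toMul v.toMul.2) : v.toMul ^ p = 1)) (MonoidHom.toAdditive f)
    (fun v => congrArg Additive.ofMul (show f^[p] v.toMul = f v.toMul from Subtype.ext (by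
      rw [hpow, hyp]; rfl)))
  exact ⟨v.toMul, v.toMul.2, fun h => hv (congrArg Additive.ofMul
    (Subtype.ext h : v.toMul = 1)), k, congrArg (fun x : Additive A => (x.toMul : G)) hk⟩

end Eigenvector

section NormalPSubgroup

theorem Subgroup.le_normalizer_of_le_centralizer {G : Type*} [Group G] {Q E : Subgroup G}
    (h : E ≤ Subgroup.centralizer (Q : Set G)) : Q ≤ Subgroup.normalizer (E : Set G) := by
  rw [Subgroup.le_normalizer_iff]
  intro g hg x hx
  rw [Subgroup.mem_centralizer_iff.1 (h hx) g hg, mul_inv_cancel_right]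
  exact hx

variable {G : Type*} [Group G] [Finite G]

/-- A group with a normal Sylow `p`-subgroup such that the steps above subgroups of order `p`
have prime index, although this fails above some other subgroup of prime order. -/
def IsExceptional (G : Type*) [Group G] : Prop :=
  ∃ p : ℕ, p.Prime ∧ ∃ A : Subgroup G, A.Normal ∧ IsPGroup p A ∧ ¬ p ∣ A.index ∧
    (∃ P : Subgroup G, Nat.card P = p ∧ PrimeStepsAbove P) ∧
    ∃ Q : Subgroup G, (Nat.card Q).Prime ∧ Nat.card Q ≠ p ∧ ¬ PrimeStepsAbove Q

theorem UniformAbove.primeStepsAbove_of_isExceptional (h : UniformAbove (⊥ : Subgroup G))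
    (h' : IsExceptional G) : PrimeStepsAbove (⊥ : Subgroup G) := by
  obtain ⟨p, hp, -, -, -, -, ⟨P, hP, hgood⟩, -⟩ := h'
  exact h.primeStepsAbove_of_prime bot_le (by rwa [Subgroup.relIndex_bot_left, hP]) hgood

theorem IsPGroup.exists_minimal_normal {p : ℕ} [hp : Fact p.Prime] {A : Subgroup G}
    (hAn : A.Normal) (hA : IsPGroup p A) (hne : A ≠ ⊥) :
    ∃ B ≤ A, B.Normal ∧ B ≠ ⊥ ∧ (∀ C : Subgroup G, C.Normal → C ≤ B → C ≠ ⊥ → C = B) ∧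
      (∀ a ∈ B, ∀ b ∈ B, a * b = b * a) ∧ ∀ a ∈ B, a ^ p = 1 := by
  obtain ⟨B, hBA, ⟨hBn, hB⟩, hmin⟩ := exists_minimal_le_of_wellFoundedLT
    (fun B : Subgroup G => B.Normal ∧ B ≠ ⊥) A ⟨hAn, hne⟩
  have hmin' : ∀ C : Subgroup G, C.Normal → C ≤ B → C ≠ ⊥ → C = B := fun C h1 h2 h3 =>
    le_antisymm h2 (hmin ⟨h1, h3⟩ h2)
  let C : Subgroup G :=
    { carrier := {x | x ∈ B ∧ (∀ b ∈ B, b * x = x * b) ∧ x ^ p = 1}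
      one_mem' := ⟨B.one_mem, by simp, one_pow p⟩
      mul_mem' := by
        rintro x y ⟨hx, hxc, hxp⟩ ⟨hy, hyc, hyp⟩
        refine ⟨B.mul_mem hx hy, fun b hb => ?_, ?_⟩
        · rw [← mul_assoc, hxc b hb, mul_assoc, hyc b hb, mul_assoc]
        · rw [(show Commute x y from hyc x hx).mul_pow, hxp, hyp, one_mul]
      inv_mem' := by
        rintro x ⟨hx, hxc, hxp⟩
        exact ⟨B.inv_mem hx, fun b hb => (show Commute b x from hxc b hb).inv_right,
          by rw [inv_pow, hxp, inv_one]⟩ }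
  have hCn : C.Normal := by
    refine ⟨fun x hx g => ⟨hBn.conj_mem x hx.1 g, fun b hb => ?_, ?_⟩⟩
    · have h1 : g⁻¹ * b * g ∈ B := by simpa using hBn.conj_mem b hb g⁻¹
      calc b * (g * x * g⁻¹) = g * ((g⁻¹ * b * g) * x) * g⁻¹ := by group
        _ = g * x * g⁻¹ * b := by rw [hx.2.1 _ h1]; group
    · rw [conj_pow, hx.2.2, mul_one, mul_inv_cancel]
  have hC : C ≠ ⊥ := by
    have : Nontrivial B := (Subgroup.nontrivial_iff_ne_bot _).2 hB
    have hBp := hA.to_le hBA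
    have := hBp.center_nontrivial
    have hdvd : p ∣ Nat.card (Subgroup.center B) :=
      (hBp.to_subgroup (Subgroup.center B)).dvd_card_of_ne_bot
        ((Subgroup.nontrivial_iff_ne_bot _).1 this)
    obtain ⟨z, hz⟩ := exists_prime_orderOf_dvd_card' p hdvd
    have hzC : ((z : B) : G) ∈ C := ⟨z.1.2, fun b hb => congrArg Subtype.val
      (Subgroup.mem_center_iff.1 z.2 ⟨b, hb⟩), by
        rw [← hz, ← Subgroup.orderOf_coe, ← Subgroup.orderOf_coe, pow_orderOf_eq_one]⟩
    intro hbot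
    rw [hbot, Subgroup.mem_bot] at hzC
    rw [← Subgroup.orderOf_coe, ← Subgroup.orderOf_coe, hzC, orderOf_one] at hz
    exact hp.out.one_lt.ne hz
  have hCB := hmin' C hCn (fun x hx => hx.1) hC
  exact ⟨B, hBA, hBn, hB, hmin', fun a ha b hb => (hCB.symm ▸ hb : b ∈ C).2.1 a ha,
    fun a ha => (hCB.symm ▸ ha : a ∈ C).2.2⟩

/-- A `q`-group acting on a set of order prime to `q`, in the case of conjugation on the
difference of two subgroups. -/
theorem IsPGroup.exists_mem_centralizer_of_not_dvd {q : ℕ} [Fact q.Prime] {Q A D : Subgroup G}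
    (hQ : IsPGroup q Q) (hQA : Q ≤ Subgroup.normalizer (A : Set G))
    (hQD : Q ≤ Subgroup.normalizer (D : Set G)) (hAD : A ≤ D)
    (h : ¬ q ∣ Nat.card D - Nat.card A) :
    ∃ e ∈ D, e ∉ A ∧ e ∈ Subgroup.centralizer (Q : Set G) := by
  let _ : MulAction Q {x : G // x ∈ D ∧ x ∉ A} :=
    { smul := fun g x => ⟨g * x * (g : G)⁻¹,
        (Subgroup.mem_normalizer_iff.1 (hQD g.2) _).1 x.2.1,
        fun hx => x.2.2 ((Subgroup.mem_normalizer_iff.1 (hQA g.2) _).2 hx)⟩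
      one_smul := fun x => Subtype.ext (show (1 : G) * x * (1 : G)⁻¹ = x by simp)
      mul_smul := fun g k x => Subtype.ext
        (show (g * k : G) * x * (g * k : G)⁻¹ = g * (k * x * (k : G)⁻¹) * (g : G)⁻¹ by group) }
  have hcard : Nat.card {x : G // x ∈ D ∧ x ∉ A} = Nat.card D - Nat.card A := by
    have := Set.ncard_sdiff (s := (A : Set G)) (t := (D : Set G)) hAD (Set.toFinite _)
    exact this
  obtain ⟨e, he⟩ := hQ.nonempty_fixed_point_of_prime_not_dvd_card _ (by rwa [hcard])
  refine ⟨e, e.2.1, e.2.2, Subgroup.mem_centralizer_iff.2 fun g hg => ?_⟩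
  have : g * e * g⁻¹ = e := congrArg Subtype.val (he ⟨g, hg⟩)
  rwa [mul_inv_eq_iff_eq_mul] at this

/-- A `p`-group contained in `Q ⊔ A`, where `A` is a normal `p`-group and `Q` has order prime to
`p`, and containing `A` is equal to `A`. -/
theorem IsPGroup.eq_of_le_sup {p : ℕ} [hp : Fact p.Prime] {A B Q : Subgroup G} [A.Normal]
    (hB : IsPGroup p B) (hAB : A ≤ B) (hBQ : B ≤ Q ⊔ A) (hQ : ¬ p ∣ Nat.card Q) : B = A := by
  refine le_antisymm (Subgroup.relIndex_eq_one.1 ?_) hAB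
  obtain ⟨n, hn⟩ := IsPGroup.iff_card.1 hB
  obtain ⟨k, -, hk⟩ := (Nat.dvd_prime_pow hp.out).1
    (hn ▸ A.relIndex_dvd_card B)
  have h1 : A.relIndex B ∣ Nat.card Q := by
    have h2 := Subgroup.relIndex_mul_relIndex A B (Q ⊔ A) hAB hBQ
    rw [Subgroup.relIndex_sup_right] at h2
    exact (Dvd.intro _ h2).trans (A.relIndex_dvd_card Q)
  rw [hk] at h1 ⊢
  have : k = 0 := by
    by_contra h0
    exact hQ ((dvd_pow_self p h0).trans h1)
  rw [this, pow_zero]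

/-- The key step: in a group which has uniform chains at all subgroups of prime order and prime
steps above its nontrivial normal subgroups of prime power order, a minimal normal `p`-subgroup is a
Sylow subgroup unless some subgroup of order `q ≠ p` normalizes a subgroup of order `p`. -/
theorem UniformAtPrimes.not_dvd_index (hG : UniformAtPrimes G)
    (hquot : ∀ (r : ℕ) (N : Subgroup G), r.Prime → N.Normal → IsPGroup r N → N ≠ ⊥ →
      PrimeStepsAbove N)
    {p q : ℕ} [hp : Fact p.Prime] [hq : Fact q.Prime] (hqp : q ≠ p) {A P Q : Subgroup G}
    (hAn : A.Normal) (hA : IsPGroup p A) (hne : A ≠ ⊥)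
    (hmin : ∀ C : Subgroup G, C.Normal → C ≤ A → C ≠ ⊥ → C = A)
    (hcomm : ∀ a ∈ A, ∀ b ∈ A, a * b = b * a) (hexp : ∀ a ∈ A, a ^ p = 1)
    (hP : Nat.card P = p) (hgood : PrimeStepsAbove P) (hQ : Nat.card Q = q)
    (hbad : ∀ E : Subgroup G, Nat.card E = p → ¬ Q ≤ Subgroup.normalizer (E : Set G)) :
    ¬ p ∣ A.index := by
  intro hdvd
  have hpQ : ¬ p ∣ Nat.card Q := by
    rw [hQ, Nat.prime_dvd_prime_iff_eq hp.out hq.out]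
    exact hqp.symm
  have hQp : IsPGroup q Q := IsPGroup.of_card (n := 1) (by rw [hQ, pow_one])
  have hQA : Q ≤ Subgroup.normalizer (A : Set G) := by
    rw [Subgroup.normalizer_eq_top]; exact le_top
  have hbadC : ∀ e ∈ Subgroup.centralizer (Q : Set G), ∀ D : Subgroup G, IsPGroup p D → e ∈ D →
      e = 1 := by
    intro e he D hD heD
    by_contra he1
    obtain ⟨E, hEe, hE⟩ := Subgroup.exists_le_card_eq_prime hp.out
      ((hD.to_le ((Subgroup.zpowers_le).2 heD)).dvd_card_of_ne_bot
        (by rwa [Ne, Subgroup.zpowers_eq_bot]))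
    exact hbad E hE (Subgroup.le_normalizer_of_le_centralizer
      (hEe.trans ((Subgroup.zpowers_le).2 he)))
  have hAgood := hquot p A hp.out hAn hA hne
  have hmax : ∀ M : Subgroup G, IsCoatom M → M.index.Prime := by
    intro M hM
    rw [← Subgroup.relIndex_top_right]
    by_cases hAM : A ≤ M
    · exact hAgood M ⊤ hAM (covBy_top_iff.2 hM)
    have hsup : M ⊔ A = ⊤ := hM.2 _ (left_lt_sup.2 hAM)
    have hMA : M ≤ Subgroup.normalizer (A : Set G) := by
      rw [Subgroup.normalizer_eq_top]; exact le_top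
    have hinf : M ⊓ A = ⊥ := by
      by_contra hne'
      refine hAM (inf_eq_right.1 (hmin _ ?_ inf_le_right hne'))
      rw [← Subgroup.normalizer_eq_top_iff, ← top_le_iff, ← hsup, sup_le_iff,
        Subgroup.le_normalizer_iff, Subgroup.le_normalizer_iff]
      refine ⟨fun g hg x hx => ⟨M.mul_mem (M.mul_mem hg hx.1) (M.inv_mem hg),
        hAn.conj_mem x hx.2 g⟩, fun g hg x hx => ?_⟩
      rw [hcomm g hg x hx.2, mul_inv_cancel_right]
      exact hx
    have hidx := Subgroup.relIndex_sup_of_le_normalizer hMA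
    rw [hsup, ← Subgroup.inf_relIndex_right M A, hinf, Subgroup.relIndex_bot_left] at hidx
    have h1 := M.card_mul_index
    rw [← Subgroup.relIndex_top_right, hidx, ← A.card_mul_index, mul_comm] at h1
    have h2 := Nat.eq_of_mul_eq_mul_left Nat.card_pos h1
    obtain ⟨E, hEM, hE⟩ := Subgroup.exists_le_card_eq_prime hp.out (h2.symm ▸ hdvd)
    exact hG.primeStepsAbove_of_card_eq hp.out hP hE hgood M ⊤ hEM (covBy_top_iff.2 hM)
  have hG1 : (Nat.card G).primeFactors.Nonempty :=
    ⟨q, Nat.mem_primeFactors.2 ⟨hq.out, hQ ▸ Q.card_subgroup_dvd_card, Nat.card_pos.ne'⟩⟩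
  obtain ⟨r, hr, hrmax⟩ := (Nat.card G).primeFactors.exists_max_image id hG1
  have hrp := Nat.prime_of_mem_primeFactors hr
  have hrG := Nat.dvd_of_mem_primeFactors hr
  have : Fact r.Prime := ⟨hrp⟩
  obtain ⟨R⟩ : Nonempty (Sylow r G) := inferInstance
  have hrmax' : ∀ t, t.Prime → t ∣ Nat.card G → t ≤ r := fun t ht htG =>
    hrmax t (Nat.mem_primeFactors.2 ⟨ht, htG, Nat.card_pos.ne'⟩)
  have hRn := R.normal_of_forall_prime_index hmax hrmax'
  by_cases hpr : p = r
  · subst hpr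
    have hAR : A ≤ R := hA.le_sylow_of_normal R
    have hVR : (Q ⊔ A) ⊓ R = A := (R.isPGroup'.to_le inf_le_right).eq_of_le_sup
      (le_inf le_sup_right hAR) inf_le_left hpQ
    have hRV : ¬ (R : Subgroup G) ≤ Q ⊔ A := by
      intro hle
      rw [inf_eq_right.2 hle] at hVR
      exact R.not_dvd_index (hVR ▸ hdvd)
    obtain ⟨D, hDR, hAD, hVD, hD⟩ := (hAgood.mono
      (le_sup_right : A ≤ Q ⊔ A)).exists_le_normalizer hRV
    rw [hVR] at hAD hD
    have hDp : IsPGroup p D := R.isPGroup'.to_le hDR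
    have hcardD := Subgroup.card_mul_relIndex_of_le hAD
    have hAD' : A.relIndex D = p := by
      obtain ⟨n, hn⟩ := IsPGroup.iff_card.1 hDp
      exact (Nat.prime_dvd_prime_iff_eq hD hp.out).1 (hD.dvd_of_dvd_pow
        (hn ▸ A.relIndex_dvd_card D))
    rw [hAD'] at hcardD
    by_cases hqp1 : q ∣ p - 1
    · obtain ⟨y, hy⟩ := (isCyclic_of_prime_card hQ).exists_generator
      have hyq : (y : G) ^ q = 1 := by
        rw [← hQ, ← Subgroup.coe_pow, pow_card_eq_one', Subgroup.coe_one]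
      have hyp : (y : G) ^ p = y := by
        obtain ⟨k, hk⟩ := hqp1
        have : p = q * k + 1 := by have := hp.out.pos; omega
        rw [this, pow_succ, pow_mul, hyq, one_pow, one_mul]
      obtain ⟨v, hvA, hv1, k, hk⟩ := Subgroup.exists_conj_eq_pow hcomm hexp hne
        (fun a ha => hAn.conj_mem a ha y) hyp
      refine hbad (Subgroup.zpowers v) ?_ ?_
      · rw [Nat.card_zpowers]
        exact orderOf_eq_prime (hexp v hvA) hv1
      · have hQy : Q ≤ Subgroup.zpowers (y : G) := by
          intro x hx
          obtain ⟨n, hn⟩ := Subgroup.mem_zpowers_iff.1 (hy ⟨x, hx⟩)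
          exact ⟨n, by simpa using congrArg Subtype.val hn⟩
        refine hQy.trans ((Subgroup.zpowers_le).2 ?_)
        rw [Subgroup.mem_normalizer_iff_map_conj_eq]
        refine Subgroup.eq_of_le_of_card_ge ?_ ?_
        · rw [MonoidHom.map_zpowers, Subgroup.zpowers_le]
          exact ⟨k, by simpa using hk.symm⟩
        · exact (Nat.card_congr ((Subgroup.zpowers v).equivMapOfInjective _
            (MulAut.conj (y : G)).injective).toEquiv).le
    · obtain ⟨e, heD, heA, heQ⟩ := hQp.exists_mem_centralizer_of_not_dvd hQA
        (le_sup_left.trans hVD) hAD (by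
          rw [← hcardD, ← Nat.mul_sub_one, hq.out.dvd_mul, not_or]
          refine ⟨fun h => hqp ?_, hqp1⟩
          obtain ⟨n, hn⟩ := IsPGroup.iff_card.1 hA
          rw [hn] at h
          exact (Nat.prime_dvd_prime_iff_eq hq.out hp.out).1 (hq.out.dvd_of_dvd_pow h))
      exact heA (hbadC e heQ D hDp heD ▸ A.one_mem)
  · obtain ⟨E, -, hE, hQE⟩ := PrimeStepsAbove.exists_le_normalizer_of_normal hpr R.isPGroup'
      (hquot r R hrp hRn R.isPGroup' (R.ne_bot_of_dvd_card hrG)) hA hne hpQ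
    exact hbad E hE hQE

theorem UniformAtPrimes.primeSteps_or_isExceptional_of_normal (hG : UniformAtPrimes G)
    (hquot : ∀ (r : ℕ) (N : Subgroup G), r.Prime → N.Normal → IsPGroup r N → N ≠ ⊥ →
      PrimeStepsAbove N)
    {p : ℕ} (hp : p.Prime) {N : Subgroup G} (hNn : N.Normal) (hN : IsPGroup p N)
    (hne : N ≠ ⊥) : PrimeStepsAbove (⊥ : Subgroup G) ∨ IsExceptional G := by
  have := Fact.mk hp
  obtain ⟨A, hAN, hAn, hA1, hmin, hcomm, hexp⟩ := hN.exists_minimal_normal hNn hne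
  have hA := hN.to_le hAN
  obtain ⟨P, hPA, hP⟩ := Subgroup.exists_le_card_eq_prime hp (hA.dvd_card_of_ne_bot hA1)
  have hgood : PrimeStepsAbove P := by
    obtain ⟨n, hn⟩ := CoverChain.exists_of_le hPA
    refine (hG P (hP ▸ hp)).primeStepsAbove_of_chain ?_ (hquot p A hp hAn hA hA1)
    rwa [← hA.length_eq hn]
  by_cases hall : ∀ Q : Subgroup G, (Nat.card Q).Prime → PrimeStepsAbove Q
  · left
    intro B C _ hBC
    by_cases hB : B = ⊥
    · subst hB
      have h1 : Nat.card C ≠ 1 := fun h => hBC.lt.ne' (Subgroup.card_eq_one.1 h)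
      obtain ⟨E, hEC, hE⟩ := Subgroup.exists_le_card_eq_prime (Nat.minFac_prime h1)
        (Nat.minFac_dvd (Nat.card C))
      have hEb : E ≠ ⊥ := fun h => by
        rw [h, Subgroup.card_bot] at hE
        exact (Nat.minFac_prime h1).one_lt.ne hE
      rw [← (hBC.eq_or_eq bot_le hEC).resolve_left hEb, Subgroup.relIndex_bot_left, hE]
      exact Nat.minFac_prime h1
    · have h1 : Nat.card B ≠ 1 := fun h => hB (Subgroup.card_eq_one.1 h)
      obtain ⟨E, hEB, hE⟩ := Subgroup.exists_le_card_eq_prime (Nat.minFac_prime h1)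
        (Nat.minFac_dvd (Nat.card B))
      exact hall E (hE ▸ Nat.minFac_prime h1) B C hEB hBC
  · right
    push Not at hall
    obtain ⟨Q, hQ, hQbad⟩ := hall
    have hqp : Nat.card Q ≠ p := fun h =>
      hQbad (hG.primeStepsAbove_of_card_eq hp hP h hgood)
    have := Fact.mk hQ
    exact ⟨p, hp, A, hAn, hA, hG.not_dvd_index hquot hqp hAn hA hA1 hmin hcomm hexp hP hgood rfl
      fun E hE hQE => hQbad (hG.primeStepsAbove_of_le_normalizer hp hQ hqp.symm hP hgood hE rfl
        hQE), ⟨P, hP, hgood⟩, Q, hQ, hqp, hQbad⟩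

end NormalPSubgroup

section NoNormalPSubgroup

open ArithmeticFunction

open scoped ArithmeticFunction.Omega

variable {G : Type*} [Group G] [Finite G]

theorem PrimeStepsAbove.exists_sylow_normal (h : PrimeStepsAbove (⊥ : Subgroup G)) [Nontrivial G] :
    ∃ r, r.Prime ∧ r ∣ Nat.card G ∧ (∀ t, t.Prime → t ∣ Nat.card G → t ≤ r) ∧
      ∃ R : Sylow r G, (R : Subgroup G).Normal := by
  have hG1 : (Nat.card G).primeFactors.Nonempty :=
    Nat.nonempty_primeFactors.2 Finite.one_lt_card
  obtain ⟨r, hr, hrmax⟩ := (Nat.card G).primeFactors.exists_max_image id hG1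
  have : Fact r.Prime := ⟨Nat.prime_of_mem_primeFactors hr⟩
  have hrmax' : ∀ t, t.Prime → t ∣ Nat.card G → t ≤ r := fun t ht htG =>
    hrmax t (Nat.mem_primeFactors.2 ⟨ht, htG, Nat.card_pos.ne'⟩)
  obtain ⟨R⟩ : Nonempty (Sylow r G) := inferInstance
  refine ⟨r, Fact.out, Nat.dvd_of_mem_primeFactors hr, hrmax', R,
    R.normal_of_forall_prime_index (fun M hM => ?_) hrmax'⟩
  rw [← Subgroup.relIndex_top_right]
  exact h M ⊤ bot_le (covBy_top_iff.2 hM)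

theorem exists_characteristic_isPGroup
    (h : PrimeStepsAbove (⊥ : Subgroup G) ∨ IsExceptional G) [Nontrivial G] :
    ∃ r, r.Prime ∧ ∃ R : Subgroup G, R.Characteristic ∧ IsPGroup r R ∧ R ≠ ⊥ := by
  suffices ∃ r, r.Prime ∧ r ∣ Nat.card G ∧ ∃ R : Sylow r G, (R : Subgroup G).Normal by
    obtain ⟨r, hr, hrG, R, hR⟩ := this
    have : Fact r.Prime := ⟨hr⟩
    exact ⟨r, hr, R, R.characteristic_of_normal hR, R.isPGroup', R.ne_bot_of_dvd_card hrG⟩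
  obtain h | ⟨p, hp, A, hAn, hA, hdvd, ⟨P, hP, -⟩, -⟩ := h
  · obtain ⟨r, hr, hrG, -, R, hR⟩ := h.exists_sylow_normal
    exact ⟨r, hr, hrG, R, hR⟩
  · have : Fact p.Prime := ⟨hp⟩
    exact ⟨p, hp, hP ▸ P.card_subgroup_dvd_card, hA.toSylow hdvd, hAn⟩

theorem IsPGroup.le_of_not_dvd_index {G : Type*} [Group G] {s : ℕ} [Fact s.Prime]
    {A B : Subgroup G} [hAn : A.Normal]
    (hA : IsPGroup s A) (h : ¬ s ∣ A.index) (hB : IsPGroup s B) : B ≤ A := by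
  obtain ⟨S, hS⟩ := hB.exists_le_sylow
  have hle : A ≤ S := hA.le_sylow_of_normal S
  have : (S : Subgroup G) = (hA.toSylow h : Subgroup G) :=
    (hA.toSylow h).is_maximal' S.isPGroup' hle
  exact hS.trans this.le

theorem UniformAbove.lt_of_not_primeStepsAbove {p q : ℕ} (hp : p.Prime) (hq : q.Prime)
    {P Q : Subgroup G} (hQu : UniformAbove Q) (hP : Nat.card P = p) (hQ : Nat.card Q = q)
    (hgood : PrimeStepsAbove P) (hbad : ¬ PrimeStepsAbove Q) {m n : ℕ}
    (hm : CoverChain P ⊤ m) (hn : CoverChain Q ⊤ n) : n < m := by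
  have h1 : Ω P.index = Ω Q.index := by
    have h2 := P.card_mul_index.trans Q.card_mul_index.symm
    have h3 := congrArg (Ω ·) h2
    simp only [hP, hQ] at h3
    rw [cardFactors_mul hp.ne_zero P.index_ne_zero_of_finite,
      cardFactors_mul hq.ne_zero Q.index_ne_zero_of_finite, cardFactors_apply_prime hp,
      cardFactors_apply_prime hq] at h3
    omega
  have h4 := hgood.length_eq hm le_rfl
  have h5 := hn.length_le
  rw [Subgroup.relIndex_top_right] at h4 h5
  refine lt_of_le_of_ne (by omega) fun h => hbad (hQu.primeStepsAbove ?_)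
  rwa [← h1, ← h4, ← h]

theorem PrimeStepsAbove.length_eq_of_prime (h : PrimeStepsAbove (⊥ : Subgroup G)) {p q : ℕ}
    (hp : p.Prime) (hq : q.Prime) {P Q : Subgroup G} (hP : Nat.card P = p) (hQ : Nat.card Q = q)
    {m n : ℕ} (hm : CoverChain P ⊤ m) (hn : CoverChain Q ⊤ n) : n = m := by
  have h1 : Ω P.index = Ω Q.index := by
    have h2 := P.card_mul_index.trans Q.card_mul_index.symm
    have h3 := congrArg (Ω ·) h2
    simp only [hP, hQ] at h3
    rw [cardFactors_mul hp.ne_zero P.index_ne_zero_of_finite,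
      cardFactors_mul hq.ne_zero Q.index_ne_zero_of_finite, cardFactors_apply_prime hp,
      cardFactors_apply_prime hq] at h3
    omega
  have h4 := h.length_eq hm bot_le
  have h5 := h.length_eq hn bot_le
  rw [Subgroup.relIndex_top_right] at h4 h5
  omega

theorem UniformAtPrimes.centralizesLocally (hG : UniformAtPrimes G)
    (hno : ∀ (r : ℕ) (N : Subgroup G), r.Prime → N.Normal → IsPGroup r N → N = ⊥)
    (hsub : ∀ X : Subgroup G, X ≠ ⊤ → PrimeStepsAbove (⊥ : Subgroup X) ∨ IsExceptional X)
    {n q : ℕ} (hq : q.Prime) {Q : Subgroup G} (hQ : Nat.card Q = q) (hn : CoverChain Q ⊤ n)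
    (hmin : ∀ (s m : ℕ) (S : Subgroup G), s.Prime → Nat.card S = s → CoverChain S ⊤ m →
      n ≤ m ∧ (m = n → q ≤ s)) :
    CentralizesLocally G q := by
  have : Fact q.Prime := ⟨hq⟩
  intro H hH hne y hy s hs hsq hk
  have : Fact s.Prime := ⟨hs⟩
  by_contra hyC
  have hys : IsPGroup s (Subgroup.zpowers y) := by
    obtain ⟨k, hk⟩ := hk
    exact IsPGroup.of_card (n := k) (by rw [Nat.card_zpowers, hk])
  have hy1 : Subgroup.zpowers y ≠ ⊥ := by
    rw [Ne, Subgroup.zpowers_eq_bot]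
    rintro rfl
    exact hyC (Subgroup.one_mem _)
  have hyH : Subgroup.zpowers y ≤ Subgroup.normalizer (H : Set G) := (Subgroup.zpowers_le).2 hy
  obtain ⟨X, hX⟩ : ∃ X, X = Subgroup.zpowers y ⊔ H := ⟨_, rfl⟩
  have hyX : y ∈ X := hX ▸ Subgroup.mem_sup_left (Subgroup.mem_zpowers y)
  have hHX : H ≤ X := hX ▸ le_sup_right
  have hXH : X ≤ Subgroup.normalizer (H : Set G) := hX ▸ sup_le hyH Subgroup.le_normalizer
  have hprimes : ∀ t, t.Prime → t ∣ Nat.card X → t = q ∨ t = s := by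
    intro t ht htX
    by_contra! hcon
    rw [hX] at htX
    refine Subgroup.not_dvd_card_sup ht hyH ?_ ?_ htX
    · obtain ⟨k, hk⟩ := IsPGroup.iff_card.1 hys
      rw [hk]
      exact fun h => hcon.2 ((Nat.prime_dvd_prime_iff_eq ht hs).1 (ht.dvd_of_dvd_pow h))
    · obtain ⟨k, hk⟩ := IsPGroup.iff_card.1 hH
      rw [hk]
      exact fun h => hcon.1 ((Nat.prime_dvd_prime_iff_eq ht hq).1 (ht.dvd_of_dvd_pow h))
  have hXtop : X ≠ ⊤ := by
    rintro rfl
    exact hne (hno q H hq (Subgroup.normalizer_eq_top_iff.1 (top_le_iff.1 hXH)) hH)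
  have hHn : (H.subgroupOf X).Normal := Subgroup.normal_subgroupOf_iff_le_normalizer hHX |>.2 hXH
  have hHp : IsPGroup q (H.subgroupOf X) := hH.comap_of_injective X.subtype X.subtype_injective
  have hyp : IsPGroup s (Subgroup.zpowers (⟨y, hyX⟩ : X)) := by
    obtain ⟨k, hk⟩ := hk
    refine IsPGroup.of_card (n := k) ?_
    rw [Nat.card_zpowers, ← hk, Subgroup.orderOf_mk]
  have key : ∀ A : Subgroup X, A.Normal → IsPGroup s A → ¬ s ∣ A.index → False := by
    intro A hAn hA hidx
    have hyA : (⟨y, hyX⟩ : X) ∈ A :=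
      (Subgroup.zpowers_le).1 (hA.le_of_not_dvd_index hidx hyp)
    refine hyC (Subgroup.mem_centralizer_iff.2 fun x hx => ?_)
    have := Subgroup.commute_of_normal_of_disjoint _ _ hHn hAn
      (IsPGroup.disjoint_of_ne q s hsq.symm _ _ hHp hA) ⟨x, hHX hx⟩ ⟨y, hyX⟩ hx hyA
    exact congrArg Subtype.val this
  obtain ⟨m, hm⟩ := CoverChain.exists_of_le (le_top (a := X))
  have hlen : ∀ (a : ℕ) (T : Subgroup X), Nat.card T = q → CoverChain T ⊤ a → a + m = n :=
    fun a T hT ha => hG.length_eq hq ((Subgroup.card_map_subtype T).trans hT) hQ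
      (ha.map_subtype_top hm) hn
  have hlen' : ∀ (a t : ℕ) (T : Subgroup X), t.Prime → Nat.card T = t → CoverChain T ⊤ a →
      n ≤ a + m ∧ (a + m = n → q ≤ t) :=
    fun a t T ht hT ha => hmin t _ _ ht ((Subgroup.card_map_subtype T).trans hT)
      (ha.map_subtype_top hm)
  obtain hPI | ⟨p, hp, A, hAn, hA, hidx, ⟨P, hP, hgood⟩, Q₀, hQ₀, -, hbad⟩ := hsub X hXtop
  · have hsX : s ∣ Nat.card X :=
      (hys.dvd_card_of_ne_bot hy1).trans (Subgroup.card_dvd_of_le ((Subgroup.zpowers_le).2 hyX))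
    have hqX : q ∣ Nat.card X := (hH.dvd_card_of_ne_bot hne).trans (Subgroup.card_dvd_of_le hHX)
    obtain ⟨S, -, hS⟩ := Subgroup.exists_le_card_eq_prime (H := (⊤ : Subgroup X)) hs
      (by rwa [Subgroup.card_top])
    obtain ⟨T, -, hT⟩ := Subgroup.exists_le_card_eq_prime (H := (⊤ : Subgroup X)) hq
      (by rwa [Subgroup.card_top])
    obtain ⟨a, ha⟩ := CoverChain.exists_of_le (le_top (a := S))
    obtain ⟨b, hb⟩ := CoverChain.exists_of_le (le_top (a := T))
    have hqs : q ≤ s := (hlen' a s S hs hS ha).2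
      (by rw [hPI.length_eq_of_prime hq hs hT hS hb ha, hlen b T hT hb])
    obtain ⟨R⟩ : Nonempty (Sylow s X) := inferInstance
    refine key R (R.normal_of_forall_prime_index (fun M hM => ?_) fun t ht htX => ?_)
      R.isPGroup' R.not_dvd_index
    · rw [← Subgroup.relIndex_top_right]
      exact hPI M ⊤ bot_le (covBy_top_iff.2 hM)
    · obtain rfl | rfl := hprimes t ht htX
      exacts [hqs, le_rfl]
  · obtain rfl | rfl := hprimes p hp (hP ▸ P.card_subgroup_dvd_card)
    · obtain ⟨a, ha⟩ := CoverChain.exists_of_le (le_top (a := P))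
      obtain ⟨b, hb⟩ := CoverChain.exists_of_le (le_top (a := Q₀))
      have h1 := (hG.subgroup X Q₀ hQ₀).lt_of_not_primeStepsAbove hp hQ₀ hP rfl hgood hbad ha hb
      have h2 := hlen a P hP ha
      have h3 := (hlen' b _ Q₀ hQ₀ rfl hb).1
      omega
    · exact key A hAn hA hidx

theorem UniformAtPrimes.exists_normal_isPGroup (hG : UniformAtPrimes G) [Nontrivial G]
    (hsub : ∀ X : Subgroup G, X ≠ ⊤ → PrimeStepsAbove (⊥ : Subgroup X) ∨ IsExceptional X) :
    ∃ (r : ℕ) (N : Subgroup G), r.Prime ∧ N.Normal ∧ IsPGroup r N ∧ N ≠ ⊥ := by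
  classical
  by_contra! hno
  have hex : ∃ n q : ℕ, ∃ Q : Subgroup G, q.Prime ∧ Nat.card Q = q ∧ CoverChain Q ⊤ n := by
    obtain ⟨q, hq, hqG⟩ := Nat.exists_prime_and_dvd (Finite.one_lt_card (α := G)).ne'
    obtain ⟨Q, -, hQ⟩ := Subgroup.exists_le_card_eq_prime (H := (⊤ : Subgroup G)) hq
      (by rwa [Subgroup.card_top])
    obtain ⟨n, hn⟩ := CoverChain.exists_of_le (le_top (a := Q))
    exact ⟨n, q, Q, hq, hQ, hn⟩
  obtain ⟨Q, hq, hQ, hn⟩ := Nat.find_spec (Nat.find_spec hex)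
  have hloc := hG.centralizesLocally hno hsub hq hQ hn fun s m S hs hS hm =>
    ⟨Nat.find_min' hex ⟨s, S, hs, hS, hm⟩, fun h => Nat.find_min' _ ⟨S, hs, hS, h ▸ hm⟩⟩
  have := Fact.mk hq
  refine hloc.commutator_ne_top (hQ ▸ Q.card_subgroup_dvd_card) ?_
  by_contra htop
  obtain hbot | hbot := eq_or_ne (commutator G) ⊥
  · rw [commutator_eq_bot_iff_center_eq_top] at hbot
    have hQ1 : Q = ⊥ := hno _ Q hq ⟨fun x hx g => by
      rwa [Subgroup.mem_center_iff.1 (hbot ▸ Subgroup.mem_top x) g, mul_inv_cancel_right]⟩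
      (IsPGroup.of_card (n := 1) (by rw [hQ, pow_one]))
    rw [hQ1, Subgroup.card_bot] at hQ
    exact hq.one_lt.ne hQ
  · have := (Subgroup.nontrivial_iff_ne_bot _).2 hbot
    obtain ⟨r, hr, R, hRc, hR, hR1⟩ := exists_characteristic_isPGroup (hsub _ htop)
    exact hR1 ((Subgroup.map_eq_bot_iff_of_injective R (commutator G).subtype_injective).1
      (hno r _ hr (ConjAct.normal_of_characteristic_of_normal) (hR.map _)))

end NoNormalPSubgroup

/-- The steps above a nontrivial normal subgroup are of prime index, if the quotient
is of one of the two types. -/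
theorem UniformAtPrimes.primeStepsAbove_of_quotient {G : Type*} [Group G] [Finite G]
    (hG : UniformAtPrimes G) {N : Subgroup G} [N.Normal] (hne : N ≠ ⊥)
    (h : PrimeStepsAbove (⊥ : Subgroup (G ⧸ N)) ∨ IsExceptional (G ⧸ N)) : PrimeStepsAbove N :=
  _root_.primeStepsAbove_of_quotient
    (h.elim id (hG.quotient_bot hne).primeStepsAbove_of_isExceptional)

theorem UniformAtPrimes.primeSteps_or_isExceptional {G : Type*} [Group G] [Finite G]
    (hG : UniformAtPrimes G) : PrimeStepsAbove (⊥ : Subgroup G) ∨ IsExceptional G := by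
  induction hc : Nat.card G using Nat.strong_induction_on generalizing G with
  | _ n ih =>
  subst hc
  obtain hs | hs := subsingleton_or_nontrivial G
  · exact Or.inl fun A B _ hAB => absurd (Subsingleton.elim A B) hAB.lt.ne
  obtain ⟨p, N, hp, hNn, hN, hne⟩ := hG.exists_normal_isPGroup fun X hX =>
    ih _ (lt_of_le_of_ne X.card_le_card_group fun h => hX (Subgroup.card_eq_iff_eq_top X |>.1 h))
      (hG.subgroup X) rfl
  refine hG.primeSteps_or_isExceptional_of_normal (fun r M hr hMn hM hMne => ?_) hp hNn hN hne
  refine hG.primeStepsAbove_of_quotient hMne (ih _ ?_ (.of_bot (hG.quotient_bot hMne)) rfl)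
  rw [← M.index_eq_card, ← M.card_mul_index]
  exact lt_mul_left (Nat.pos_of_ne_zero M.index_ne_zero_of_finite)
    (lt_of_le_of_ne Nat.card_pos fun h => hMne (Subgroup.card_eq_one.1 h.symm))

theorem IsSupersolvable.of_quotient {G : Type*} [Group G] {N : Subgroup G} [hNn : N.Normal] {g : G}
    (hN : Subgroup.zpowers g = N) (h : IsSupersolvable (G ⧸ N)) : IsSupersolvable G := by
  obtain ⟨n, s, h0, h1, hn, hs⟩ := h
  have hsurj := QuotientGroup.mk'_surjective N
  refine ⟨n + 1, fun i => Nat.casesOn i ⊥ fun i => (s i).comap (QuotientGroup.mk' N), rfl, ?_,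
    fun i => ?_, fun i hi => ?_⟩
  · change (s n).comap (QuotientGroup.mk' N) = ⊤
    rw [h1, Subgroup.comap_top]
  · cases i with
    | zero => exact Subgroup.normal_bot
    | succ i => exact (hn i).comap _
  · cases i with
    | zero =>
      refine ⟨g, ?_⟩
      change ⊥ ⊔ Subgroup.zpowers g = (s 0).comap (QuotientGroup.mk' N)
      rw [bot_sup_eq, h0, MonoidHom.comap_bot, QuotientGroup.ker_mk', hN]
    | succ i =>
      obtain ⟨x, hx⟩ := hs i (by omega)
      obtain ⟨x, rfl⟩ := hsurj x
      refine ⟨x, ?_⟩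
      change (s i).comap (QuotientGroup.mk' N) ⊔ Subgroup.zpowers x =
        (s (i + 1)).comap (QuotientGroup.mk' N)
      have hmap : s (i + 1) = ((s i).comap (QuotientGroup.mk' N) ⊔ Subgroup.zpowers x).map
          (QuotientGroup.mk' N) := by
        rw [Subgroup.map_sup, MonoidHom.map_zpowers,
          Subgroup.map_comap_eq_self_of_surjective hsurj, hx]
      rw [hmap, Subgroup.comap_map_eq_self]
      exact (Subgroup.ker_le_comap _ _).trans le_sup_left

theorem PrimeStepsAbove.isSupersolvable {G : Type*} [Group G] [Finite G]
    (h : PrimeStepsAbove (⊥ : Subgroup G)) : IsSupersolvable G := by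
  induction hc : Nat.card G using Nat.strong_induction_on generalizing G with
  | _ n ih =>
  subst hc
  obtain hs | hs := subsingleton_or_nontrivial G
  · exact ⟨0, fun _ => ⊥, rfl, Subsingleton.elim _ _, fun _ => inferInstance,
      fun i hi => absurd hi (Nat.not_lt_zero i)⟩
  obtain ⟨r, hr, hrG, -, R, hR⟩ := h.exists_sylow_normal
  have : Fact r.Prime := ⟨hr⟩
  obtain ⟨K, hK⟩ := Subgroup.exists_right_complement'_of_coprime R.card_coprime_index
  have hRp := R.isPGroup'
  have : Nontrivial R := (Subgroup.nontrivial_iff_ne_bot _).2 (R.ne_bot_of_dvd_card hrG)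
  have := hRp.center_nontrivial
  set Z : Subgroup G := (Subgroup.center R).map (R : Subgroup G).subtype with hZ
  have hZn : Z.Normal := ConjAct.normal_of_characteristic_of_normal
  have hZR : Z ≤ R := Subgroup.map_subtype_le _
  have hZ1 : Z ≠ ⊥ := by
    rw [hZ, Ne, Subgroup.map_eq_bot_iff_of_injective _ (R : Subgroup G).subtype_injective,
      ← Ne, ← Subgroup.nontrivial_iff_ne_bot]
    exact this
  obtain ⟨E, hEZ, hE, hKE⟩ := (h.mono bot_le).exists_card_eq_le_normalizer (V := K)
    (hRp.to_le hZR) hZ1 (by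
      rw [eq_bot_iff]
      exact (inf_le_inf_left K hZR).trans (inf_comm (R : Subgroup G) K ▸ hK.disjoint.le_bot))
  have hRE : (R : Subgroup G) ≤ Subgroup.normalizer (E : Set G) := by
    refine Subgroup.le_normalizer_of_le_centralizer fun x hx => ?_
    obtain ⟨z, hz, rfl⟩ := hEZ hx
    exact Subgroup.mem_centralizer_iff.2 fun y hy =>
      congrArg Subtype.val (Subgroup.mem_center_iff.1 hz ⟨y, hy⟩)
  have hEn : E.Normal := by
    rw [← Subgroup.normalizer_eq_top_iff, ← top_le_iff, ← hK.sup_eq_top]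
    exact sup_le hRE hKE
  obtain ⟨e, he⟩ := (isCyclic_of_prime_card hE).exists_generator
  refine IsSupersolvable.of_quotient (N := E) (g := e) ?_
    (ih _ ?_ (h.mono bot_le).quotient rfl)
  · refine le_antisymm ((Subgroup.zpowers_le).2 e.2) fun x hx => ?_
    obtain ⟨n, hn⟩ := Subgroup.mem_zpowers_iff.1 (he ⟨x, hx⟩)
    exact ⟨n, by simpa using congrArg Subtype.val hn⟩
  · rw [← E.index_eq_card, ← E.card_mul_index, hE]
    exact lt_mul_left (Nat.pos_of_ne_zero E.index_ne_zero_of_finite) hr.one_lt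

section FittingSubgroup

variable {G : Type*} [Group G] [Finite G]

theorem Subgroup.le_commutator_of_forall_eq_one {A : Subgroup G} [hAn : A.Normal] {y : G}
    (h : ∀ a ∈ A, a * y = y * a → a = 1) : A ≤ _root_.commutator G := by
  let f : A → A := fun a => ⟨a * y * (a : G)⁻¹ * y⁻¹, by
    rw [mul_assoc, mul_assoc, ← mul_assoc y]
    exact A.mul_mem a.2 (hAn.conj_mem _ (A.inv_mem a.2) y)⟩
  have hf : Function.Injective f := by
    intro a b hab
    have h1 : (a : G) * y * (a : G)⁻¹ * y⁻¹ = b * y * (b : G)⁻¹ * y⁻¹ := congrArg Subtype.val hab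
    have h2 := h _ (A.mul_mem (A.inv_mem b.2) a.2) (by
      calc (b : G)⁻¹ * a * y = (b : G)⁻¹ * (a * y * (a : G)⁻¹ * y⁻¹) * y * a := by group
        _ = y * ((b : G)⁻¹ * a) := by rw [h1]; group)
    exact Subtype.ext (inv_mul_eq_one.1 h2).symm
  intro a ha
  obtain ⟨b, hb⟩ := (Finite.injective_iff_surjective.1 hf) ⟨a, ha⟩
  have h1 : (b : G) * y * (b : G)⁻¹ * y⁻¹ = a := congrArg Subtype.val hb
  rw [← h1, _root_.commutator_def, ← commutatorElement_def]
  exact Subgroup.commutator_mem_commutator (Subgroup.mem_top _) (Subgroup.mem_top _)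

theorem Subgroup.isPGroup_of_isNilpotent {p : ℕ} [hp : Fact p.Prime] {F : Subgroup G}
    [F.Normal] [Group.IsNilpotent F]
    (h : ∀ (r : ℕ) (B : Subgroup G), r.Prime → r ≠ p → B.Normal → IsPGroup r B → B = ⊥) :
    IsPGroup p F := by
  rw [IsPGroup.iff_card]
  refine ⟨_, Nat.eq_prime_pow_of_unique_prime_dvd Nat.card_pos.ne' fun {r} hr hrF => ?_⟩
  by_contra hrp
  have : Fact r.Prime := ⟨hr⟩
  obtain ⟨R⟩ : Nonempty (Sylow r F) := inferInstance
  have hRn : (R : Subgroup F).Normal :=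
    R.normal_of_normalizerCondition Group.normalizerCondition_of_isNilpotent
  have := R.characteristic_of_normal hRn
  exact R.ne_bot_of_dvd_card hrF
    ((Subgroup.map_eq_bot_iff_of_injective _ F.subtype_injective).1
      (h r _ hr hrp ConjAct.normal_of_characteristic_of_normal (R.isPGroup'.map _)))

end FittingSubgroup

theorem stmt_8 {G : Type*} [Group G] [Finite G]
    (hchains : ∀ H : Subgroup G, (Nat.card H).Prime → AllMaxChainsSameLength H)
    (F : Subgroup G) (hFnormal : F.Normal) (hFnilpotent : Group.IsNilpotent F)
    (hFmax : ∀ N : Subgroup G, N.Normal → Group.IsNilpotent N → N ≤ F)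
    (hns : ¬ IsSupersolvable G) :
    ∃ p : ℕ, p.Prime ∧ p ∣ Nat.card F ∧ F ≤ commutator G ∧
      Nat.card F = p ^ ((Nat.card (commutator G)).factorization p) := by
  have hG : UniformAtPrimes G := fun H hH => (hchains H hH).uniformAbove
  obtain hPI | ⟨p, hp, A, hAn, hA, hidx, ⟨P, hP, hgood⟩, Q, hQ, hQp, hbad⟩ :=
    hG.primeSteps_or_isExceptional
  · exact absurd hPI.isSupersolvable hns
  have : Fact p.Prime := ⟨hp⟩
  have hPA : P ≤ A :=
    hA.le_of_not_dvd_index hidx (IsPGroup.of_card (n := 1) (by rw [hP, pow_one]))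
  have hpA : p ∣ Nat.card A := hP ▸ Subgroup.card_dvd_of_le hPA
  have hA1 : A ≠ ⊥ := by
    rintro rfl
    rw [Subgroup.card_bot] at hpA
    exact hp.one_lt.ne' (Nat.dvd_one.1 hpA)
  have hpQ : ¬ p ∣ Nat.card Q := by
    rw [Nat.prime_dvd_prime_iff_eq hp hQ]
    exact hQp.symm
  have hnorm : ∀ E : Subgroup G, Nat.card E = p → ¬ Q ≤ Subgroup.normalizer (E : Set G) :=
    fun E hE hQE => hbad
      (hG.primeStepsAbove_of_le_normalizer hp hQ hQp.symm hP hgood hE rfl hQE)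
  have hFp : IsPGroup p F := by
    refine Subgroup.isPGroup_of_isNilpotent fun r B hr hrp hBn hB => ?_
    have : Fact r.Prime := ⟨hr⟩
    by_contra hB1
    obtain ⟨E, -, hE, hQE⟩ := PrimeStepsAbove.exists_le_normalizer_of_normal hrp.symm hB
      (hG.primeStepsAbove_of_quotient hB1
        (UniformAtPrimes.of_bot (hG.quotient_bot hB1)).primeSteps_or_isExceptional)
      hA hA1 hpQ
    exact hnorm E hE hQE
  obtain rfl : F = A := le_antisymm (hA.le_of_not_dvd_index hidx hFp) (hFmax A hAn hA.isNilpotent)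
  have hFle : F ≤ commutator G := by
    have : Fact (Nat.card Q).Prime := ⟨hQ⟩
    obtain ⟨y, hy⟩ := (isCyclic_of_prime_card (α := Q) rfl).exists_generator
    refine Subgroup.le_commutator_of_forall_eq_one (y := (y : G)) fun a ha hay => ?_
    by_contra ha1
    obtain ⟨E, hEa, hE⟩ := Subgroup.exists_le_card_eq_prime hp
      ((hA.to_le ((Subgroup.zpowers_le).2 ha)).dvd_card_of_ne_bot
        (by rwa [Ne, Subgroup.zpowers_eq_bot]))
    refine hnorm E hE (Subgroup.le_normalizer_of_le_centralizer
      (hEa.trans ((Subgroup.zpowers_le).2 (Subgroup.mem_centralizer_iff.2 fun x hx => ?_))))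
    obtain ⟨n, hn⟩ := Subgroup.mem_zpowers_iff.1 (hy ⟨x, hx⟩)
    have hn' : (y : G) ^ n = x := by simpa using congrArg Subtype.val hn
    rw [← hn']
    exact (show Commute a y from hay).symm.zpow_left n
  refine ⟨p, hp, hpA, hFle, ?_⟩
  obtain ⟨k, hk⟩ := IsPGroup.iff_card.1 hA
  have h1 := Subgroup.card_mul_relIndex_of_le hFle
  have h2 : ¬ p ∣ F.relIndex (commutator G) :=
    fun h => hidx (h.trans (Subgroup.relIndex_dvd_index_of_le hFle))
  rw [← h1, hk, Nat.factorization_mul (pow_ne_zero _ hp.ne_zero)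
    (F.relIndex_ne_zero_of_finite _), Finsupp.add_apply, Nat.factorization_eq_zero_of_not_dvd h2,
    hp.factorization_pow, Finsupp.single_eq_same, add_zero]
end

section
/- δ(A₅) = 16; more precisely, the subgroups of the alternating group A₅ that do not have all their maximal chains in A₅ of the same length are exactly the trivial subgroup and the 15 subgroups of order 2. -/
/-- `delta G` is the number of subgroups of `G` not all of whose maximal chains
in `G` have the same length. -/
noncomputable def delta (G : Type*) [Group G] : ℕ :=
  Nat.card {H : Subgroup G // ¬ AllMaxChainsSameLength H}

theorem card_mul_relIndex_of_le {G : Type*} [Group G] {H K : Subgroup G} (h : H ≤ K) :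
    Nat.card H * H.relIndex K = Nat.card K := by
  rw [← Subgroup.relIndex_bot_left, Subgroup.relIndex_mul_relIndex _ _ _ bot_le h,
    Subgroup.relIndex_bot_left]

theorem exists_zpowers_eq_of_card_prime {G : Type*} [Group G] {p : ℕ} [Fact p.Prime]
    {H : Subgroup G} (hH : Nat.card H = p) : ∃ x : G, Subgroup.zpowers x = H :=
  H.isCyclic_iff_exists_zpowers_eq_top.mp (isCyclic_of_prime_card hH)

section SimpleOfCardSixty

variable {G : Type*} [Group G] [Finite G] [IsSimpleGroup G]

/-- A proper subgroup `H` of a simple group embeds the group into the permutations of its cosets. -/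
theorem card_dvd_factorial_index (H : Subgroup G) (hH : H ≠ ⊤) :
    Nat.card G ∣ H.index.factorial := by
  have hbot : H.normalCore = ⊥ :=
    H.normalCore_normal.eq_bot_or_eq_top.resolve_right
      fun h => hH (top_le_iff.mp (h ▸ H.normalCore_le))
  have hinj : Function.Injective (MulAction.toPermHom G (G ⧸ H)) := by
    rw [← MonoidHom.ker_eq_bot_iff, ← Subgroup.normalCore_eq_ker, hbot]
  have h := Subgroup.card_dvd_of_injective _ hinj
  rwa [Nat.card_perm] at h

theorem card_subgroup_of_card_eq_sixty (hG : Nat.card G = 60) (H : Subgroup G) :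
    Nat.card H ∈ ({1, 2, 3, 4, 5, 6, 10, 12} : Finset ℕ) ∨ H = ⊤ := by
  by_cases hH : H = ⊤
  · exact Or.inr hH
  left
  have h1 := card_dvd_factorial_index H hH
  have h2 := H.card_mul_index
  rw [hG] at h1 h2
  have h5 : 5 ≤ H.index := by
    by_contra! hlt
    generalize H.index = n at *
    interval_cases n <;> revert h1 <;> decide
  have hle : Nat.card H ≤ 12 := by nlinarith
  generalize Nat.card H = m at *
  have hd : m ∣ 60 := ⟨_, h2.symm⟩
  clear h1 h2
  interval_cases m <;> revert hd <;> decide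

omit [Finite G] in
theorem normalizer_ne_top_of_ne (H : Subgroup G) (h1 : H ≠ ⊥) (h2 : H ≠ ⊤) :
    Subgroup.normalizer (H : Set G) ≠ ⊤ := by
  intro h
  have hn : H.Normal := Subgroup.normalizer_eq_top_iff.mp h
  exact hn.eq_bot_or_eq_top.elim h1 h2

theorem not_isCoatom_of_isMulCommutative {p : ℕ} [Fact p.Prime] (P : Sylow p G)
    (hc : IsMulCommutative (P : Subgroup G)) (h1 : (P : Subgroup G) ≠ ⊥) :
    ¬ IsCoatom (P : Subgroup G) := by
  intro hP
  have hN : Subgroup.normalizer (P : Set G) ≤ (P : Subgroup G) := by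
    by_contra hlt
    have hlt' : (P : Subgroup G) < Subgroup.normalizer (P : Set G) :=
      lt_of_le_not_ge Subgroup.le_normalizer hlt
    exact normalizer_ne_top_of_ne _ h1 hP.1 (hP.2 _ hlt')
  have hNC : Subgroup.normalizer (P : Set G) ≤ Subgroup.centralizer (P : Set G) :=
    hN.trans (Subgroup.le_centralizer (P : Subgroup G))
  have hcompl := MonoidHom.ker_transferSylow_isComplement' P hNC
  rcases (MonoidHom.normal_ker (MonoidHom.transferSylow P hNC)).eq_bot_or_eq_top with h | h
  · rw [h] at hcompl
    exact hP.1 (Subgroup.isComplement'_bot_left.mp hcompl)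
  · rw [h] at hcompl
    exact h1 (Subgroup.isComplement'_top_left.mp hcompl)

omit [IsSimpleGroup G] in
theorem exists_sylow_coe_eq {p n : ℕ} [Fact p.Prime] (H : Subgroup G)
    (hH : Nat.card H = p ^ n) (h : ¬ p ∣ Nat.card G / p ^ n) :
    ∃ P : Sylow p G, (P : Subgroup G) = H := by
  have hi : H.index = Nat.card G / p ^ n := by
    rw [← hH, ← H.card_mul_index, Nat.mul_div_cancel_left _ Nat.card_pos]
  exact ⟨(IsPGroup.of_card hH).toSylow (hi ▸ h), rfl⟩

theorem not_isCoatom_of_card (hG : Nat.card G = 60) (H : Subgroup G)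
    (hH : Nat.card H = 3 ∨ Nat.card H = 4 ∨ Nat.card H = 5) : ¬ IsCoatom H := by
  have hbot : H ≠ ⊥ := by
    rintro rfl
    simp at hH
  rcases hH with h | h | h
  · have : Fact (Nat.Prime 3) := ⟨Nat.prime_three⟩
    obtain ⟨P, rfl⟩ := exists_sylow_coe_eq (p := 3) (n := 1) H h (by rw [hG]; decide)
    have := isCyclic_of_prime_card h
    exact not_isCoatom_of_isMulCommutative P inferInstance hbot
  · obtain ⟨P, rfl⟩ := exists_sylow_coe_eq (p := 2) (n := 2) H h (by rw [hG]; decide)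
    exact not_isCoatom_of_isMulCommutative P
      (IsPGroup.isMulCommutative_of_card_eq_prime_sq (p := 2) h) hbot
  · have : Fact (Nat.Prime 5) := ⟨Nat.prime_five⟩
    obtain ⟨P, rfl⟩ := exists_sylow_coe_eq (p := 5) (n := 1) H h (by rw [hG]; decide)
    have := isCyclic_of_prime_card h
    exact not_isCoatom_of_isMulCommutative P inferInstance hbot

/-- The normalizer of a Sylow `3`-subgroup has order `6` as soon as it has even order. -/
theorem card_normalizer_of_two_dvd (hG : Nat.card G = 60) [Fact (Nat.Prime 3)] (P : Sylow 3 G)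
    (h3 : Nat.card P = 3) (h2 : 2 ∣ Nat.card (Subgroup.normalizer (P : Set G))) :
    Nat.card (Subgroup.normalizer (P : Set G)) = 6 := by
  have hmod := card_sylow_modEq_one 3 G
  rw [P.card_eq_index_normalizer] at hmod
  have hd : 3 ∣ Nat.card (Subgroup.normalizer (P : Set G)) := by
    exact h3.symm.dvd.trans (Subgroup.card_dvd_of_le Subgroup.le_normalizer)
  have hmul := (Subgroup.normalizer (P : Set G)).card_mul_index
  have hne : Nat.card (Subgroup.normalizer (P : Set G)) ≠ 60 := by
    intro h
    refine normalizer_ne_top_of_ne (P : Subgroup G) ?_ ?_ (Subgroup.eq_top_of_card_eq _ (h.trans hG.symm))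
    · intro hb
      rw [← Subgroup.card_eq_one] at hb
      omega
    · intro ht
      rw [← Subgroup.card_eq_iff_eq_top] at ht
      omega
  rw [hG] at hmul
  generalize Nat.card (Subgroup.normalizer (P : Set G)) = m at *
  generalize (Subgroup.normalizer (P : Set G)).index = n at *
  obtain ⟨k, rfl⟩ : 6 ∣ m := by omega
  have hk : k * n = 10 := by nlinarith
  have : k ∣ 10 := ⟨n, hk.symm⟩
  have hk10 : k ≤ 10 := Nat.le_of_dvd (by norm_num) this
  unfold Nat.ModEq at hmod
  interval_cases k <;> omega

theorem eq_of_le_normalizer_of_card_eq_six (hG : Nat.card G = 60) (H K : Subgroup G)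
    (hH : Nat.card H = 6) (hHK : H ≤ K) (hK : K ≤ Subgroup.normalizer (H : Set G)) : H = K := by
  have : Fact (Nat.Prime 3) := ⟨Nat.prime_three⟩
  obtain ⟨x, hx⟩ := exists_prime_orderOf_dvd_card' (G := H) 3 (by rw [hH]; decide)
  have hQ : Nat.card (Subgroup.zpowers (x : G)) = 3 := by
    rw [Nat.card_zpowers, Subgroup.orderOf_coe, hx]
  obtain ⟨P, hP⟩ := exists_sylow_coe_eq (p := 3) (n := 1) _ hQ (by rw [hG]; decide)
  have hPH : (P : Subgroup G) ≤ H := by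
    rw [hP, Subgroup.zpowers_le]
    exact x.2
  have h3 : Nat.card P = 3 := (congrArg (fun K : Subgroup G => Nat.card K) hP).trans hQ
  have hrel : (P : Subgroup G).relIndex H = 2 := by
    have := card_mul_relIndex_of_le hPH
    rw [hH] at this
    change Nat.card P * _ = 6 at this
    rw [h3] at this
    omega
  have hn : ((P : Subgroup G).subgroupOf H).Normal := Subgroup.normal_of_index_eq_two hrel
  have hHN : H ≤ Subgroup.normalizer (P : Set G) :=
    Subgroup.le_normalizer_of_normal_subgroupOf hPH
  have h6 : Nat.card (Subgroup.normalizer (P : Set G)) = 6 := by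
    refine card_normalizer_of_two_dvd hG P h3 (dvd_trans ?_ (Subgroup.card_dvd_of_le hHN))
    rw [hH]
    decide
  have hHeq : H = Subgroup.normalizer (P : Set G) :=
    Subgroup.eq_of_le_of_card_ge hHN (by omega)
  refine le_antisymm hHK (hK.trans ?_)
  have := P.normalizer_normalizer
  rw [← hHeq] at this
  exact this.le

/-- The covering relations between subgroups of order at least `3`. -/
theorem card_of_covBy (hG : Nat.card G = 60) {H K : Subgroup G} (h : H ⋖ K)
    (h3 : 3 ≤ Nat.card H) :
    (Nat.card H < 6 ∧ 6 ≤ Nat.card K ∧ Nat.card K < 60) ∨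
      (6 ≤ Nat.card H ∧ Nat.card H < 60 ∧ Nat.card K = 60) := by
  have hHt : H ≠ ⊤ := h.lt.ne_top
  have hH := (card_subgroup_of_card_eq_sixty hG H).resolve_right hHt
  obtain ⟨m, hm⟩ := Subgroup.card_dvd_of_le h.le
  have hlt : Nat.card H < Nat.card K := by
    by_contra! hle
    exact h.lt.ne (Subgroup.eq_of_le_of_card_ge h.le hle)
  rcases card_subgroup_of_card_eq_sixty hG K with hK | rfl
  · have h612 : ¬ (Nat.card H = 6 ∧ Nat.card K = 12) := by
      rintro ⟨h6, h12⟩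
      have hrel : H.relIndex K = 2 := by
        have := card_mul_relIndex_of_le h.le
        rw [h6, h12] at this
        omega
      have : (H.subgroupOf K).Normal := Subgroup.normal_of_index_eq_two hrel
      exact h.lt.ne (eq_of_le_normalizer_of_card_eq_six hG H K h6 h.le
        (Subgroup.le_normalizer_of_normal_subgroupOf h.le))
    simp only [Finset.mem_insert, Finset.mem_singleton] at hH hK
    rcases hH with hH | hH | hH | hH | hH | hH | hH | hH <;> rw [hH] at hm h3 hlt h612 ⊢ <;> omega
  · have hc := mt (not_isCoatom_of_card hG H) (not_not.mpr (covBy_top_iff.mp h))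
    rw [Subgroup.card_top, hG]
    simp only [Finset.mem_insert, Finset.mem_singleton] at hH
    omega

end SimpleOfCardSixty

section MaximalChains

variable {G : Type*} [Group G]

theorem IsMaxChainOf.tail {H : Subgroup G} {r : ℕ} {c : ℕ → Subgroup G}
    (h : IsMaxChainOf H (r + 1) c) : H ⋖ c 1 ∧ IsMaxChainOf (c 1) r (fun i => c (i + 1)) := by
  obtain ⟨h0, h1, h2⟩ := h
  exact ⟨h0 ▸ h2 0 r.succ_pos, rfl, h1, fun i hi => h2 (i + 1) (by omega)⟩

theorem isMaxChainOf_top : IsMaxChainOf (⊤ : Subgroup G) 0 (fun _ => ⊤) :=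
  ⟨rfl, rfl, fun _ hi => absurd hi (Nat.not_lt_zero _)⟩

theorem IsMaxChainOf.cons {H K : Subgroup G} {r : ℕ} {c : ℕ → Subgroup G} (hHK : H ⋖ K)
    (h : IsMaxChainOf K r c) :
    IsMaxChainOf H (r + 1) (fun i => Nat.casesOn i H c) := by
  obtain ⟨h0, h1, h2⟩ := h
  refine ⟨rfl, h1, ?_⟩
  rintro (_ | i) hi
  · simpa [h0] using hHK
  · exact h2 i (by omega)

theorem covBy_of_relIndex_prime [Finite G] {H K : Subgroup G} (hle : H ≤ K)
    (hp : (H.relIndex K).Prime) : H ⋖ K := by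
  refine ⟨lt_of_le_of_ne hle ?_, fun L hHL hLK => ?_⟩
  · rintro rfl
    simp [Nat.not_prime_one] at hp
  · rw [← Subgroup.relIndex_mul_relIndex H L K hHL.le hLK.le, Nat.prime_mul_iff] at hp
    rcases hp with ⟨-, h⟩ | ⟨-, h⟩
    · exact hLK.not_ge (Subgroup.relIndex_eq_one.mp h)
    · exact hHL.not_ge (Subgroup.relIndex_eq_one.mp h)

theorem covBy_of_card_eq_mul_prime [Finite G] {H K : Subgroup G} (hle : H ≤ K) {p : ℕ}
    (hp : p.Prime) (h : Nat.card K = Nat.card H * p) : H ⋖ K := by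
  refine covBy_of_relIndex_prime hle ?_
  have := card_mul_relIndex_of_le hle
  rw [h] at this
  rwa [Nat.eq_of_mul_eq_mul_left Nat.card_pos this]

end MaximalChains

section ChainLengths

variable {G : Type*} [Group G] [Finite G] [IsSimpleGroup G]

theorem IsMaxChainOf.length_eq (hG : Nat.card G = 60) {r : ℕ} {H : Subgroup G}
    {c : ℕ → Subgroup G} (h3 : 3 ≤ Nat.card H) (h : IsMaxChainOf H r c) :
    r = if Nat.card H = 60 then 0 else if 6 ≤ Nat.card H then 1 else 2 := by
  induction r generalizing H c with
  | zero =>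
    obtain ⟨h0, h1, -⟩ := h
    rw [if_pos]
    rw [← h0, h1, Subgroup.card_top, hG]
  | succ r ih =>
    obtain ⟨hcov, htail⟩ := h.tail
    have hcard := card_of_covBy hG hcov h3
    have := ih (by omega) htail
    rw [this]
    split_ifs <;> omega

theorem allMaxChainsSameLength_of_three_le (hG : Nat.card G = 60) {H : Subgroup G}
    (h3 : 3 ≤ Nat.card H) : AllMaxChainsSameLength H := fun _ _ _ _ hc hd =>
  (hc.length_eq hG h3).trans (hd.length_eq hG h3).symm

/-- A subgroup of order `2` has a maximal chain of length `3`, through a Sylow `2`-subgroup. -/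
theorem exists_isMaxChainOf_three (hG : Nat.card G = 60) {H : Subgroup G} (hH : Nat.card H = 2) :
    ∃ c, IsMaxChainOf H 3 c := by
  obtain ⟨P, hP, hHP⟩ := Sylow.exists_subgroup_card_pow_prime_le (G := G) 2 (n := 1) (m := 2)
    (by rw [hG]; decide) H hH (by decide)
  have hcov : H ⋖ P := covBy_of_card_eq_mul_prime hHP Nat.prime_two (by rw [hH, hP]; rfl)
  have hPt : P ≠ ⊤ := by
    rintro rfl
    rw [Subgroup.card_top, hG] at hP
    omega
  obtain ⟨N, hPN, hN⟩ : ∃ N, P < N ∧ N ≠ ⊤ := by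
    have := not_isCoatom_of_card hG P (by omega)
    simp only [IsCoatom, not_and, not_forall] at this
    obtain ⟨N, h1, h2⟩ := this hPt
    exact ⟨N, h1, h2⟩
  have hN12 : Nat.card N = 12 := by
    have h1 := (card_subgroup_of_card_eq_sixty hG N).resolve_right hN
    have h2 := Subgroup.card_dvd_of_le hPN.le
    have h3 : Nat.card N ≠ 4 := fun h4 =>
      hPN.ne (Subgroup.eq_of_le_of_card_ge hPN.le (by omega))
    simp only [Finset.mem_insert, Finset.mem_singleton] at h1
    rw [hP] at h2
    omega
  have hcov2 : P ⋖ N := covBy_of_card_eq_mul_prime hPN.le Nat.prime_three (by omega)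
  have hcov3 : N ⋖ ⊤ := covBy_of_card_eq_mul_prime le_top Nat.prime_five
    (by rw [Subgroup.card_top, hG, hN12])
  exact ⟨_, .cons hcov (.cons hcov2 (.cons hcov3 isMaxChainOf_top))⟩

/-- If an involution inverts an element of order `3`, the subgroup it generates has a maximal chain
of length `2`, through the normalizer of a Sylow `3`-subgroup. -/
theorem exists_isMaxChainOf_two (hG : Nat.card G = 60) {x y : G} (hx : orderOf x = 2)
    (hy : orderOf y = 3) (hxy : x * y * x⁻¹ = y⁻¹) :
    ∃ c, IsMaxChainOf (Subgroup.zpowers x) 2 c := by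
  have : Fact (Nat.Prime 3) := ⟨Nat.prime_three⟩
  have hQ : Nat.card (Subgroup.zpowers y) = 3 := by rw [Nat.card_zpowers, hy]
  obtain ⟨P, hP⟩ := exists_sylow_coe_eq (p := 3) (n := 1) _ hQ (by rw [hG]; decide)
  have h3 : Nat.card P = 3 := (congrArg (fun K : Subgroup G => Nat.card K) hP).trans hQ
  have hxN : x ∈ Subgroup.normalizer (P : Set G) := by
    rw [← Sylow.coe_coe, hP]
    refine Subgroup.mem_normalizer_fintype ?_
    rintro _ ⟨k, rfl⟩
    simp only [SetLike.mem_coe]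
    rw [← conj_zpow, hxy]
    exact zpow_mem (inv_mem (Subgroup.mem_zpowers y)) k
  have hle : Subgroup.zpowers x ≤ Subgroup.normalizer (P : Set G) := Subgroup.zpowers_le.mpr hxN
  have hcx : Nat.card (Subgroup.zpowers x) = 2 := by rw [Nat.card_zpowers, hx]
  have h6 := card_normalizer_of_two_dvd hG P h3 (hcx ▸ Subgroup.card_dvd_of_le hle)
  have hcov : Subgroup.zpowers x ⋖ Subgroup.normalizer (P : Set G) :=
    covBy_of_card_eq_mul_prime hle Nat.prime_three (by omega)
  have hcov2 : Subgroup.normalizer (P : Set G) ⋖ ⊤ := by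
    refine ⟨lt_top_iff_ne_top.mpr fun h => ?_, fun L hL hLt => ?_⟩
    · rw [h, Subgroup.card_top] at h6
      omega
    · have hcovL := (card_subgroup_of_card_eq_sixty hG L).resolve_right hLt.ne
      have hd := Subgroup.card_dvd_of_le hL.le
      have hne : Nat.card L ≠ 6 := fun h =>
        hL.ne (Subgroup.eq_of_le_of_card_ge hL.le (by omega))
      simp only [Finset.mem_insert, Finset.mem_singleton] at hcovL
      rw [h6] at hd
      have h12 : Nat.card L = 12 := by omega
      have hcov3 : Subgroup.normalizer (P : Set G) ⋖ L :=
        covBy_of_card_eq_mul_prime hL.le Nat.prime_two (by omega)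
      have := card_of_covBy hG hcov3 (by omega)
      omega
  exact ⟨_, .cons hcov (.cons hcov2 isMaxChainOf_top)⟩

end ChainLengths

section Involutions

/-- Subgroups of order `2` correspond to elements of order `2`. -/
theorem card_subgroup_card_eq_two (G : Type*) [Group G] :
    Nat.card {H : Subgroup G // Nat.card H = 2} = Nat.card {x : G // orderOf x = 2} := by
  symm
  refine Nat.card_eq_of_bijective
    (fun x => ⟨Subgroup.zpowers x.1, by rw [Nat.card_zpowers, x.2]⟩) ⟨?_, ?_⟩
  · rintro ⟨x, hx⟩ ⟨y, hy⟩ hxy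
    have h : x ∈ Subgroup.zpowers y := by
      rw [← show Subgroup.zpowers x = Subgroup.zpowers y from Subtype.ext_iff.mp hxy]
      exact Subgroup.mem_zpowers x
    have hfin : IsOfFinOrder y := orderOf_pos_iff.mp (by omega)
    classical
    rw [hfin.mem_zpowers_iff_mem_range_orderOf, Finset.mem_image] at h
    obtain ⟨k, hk, hkx⟩ := h
    rw [hy, Finset.mem_range] at hk
    ext
    interval_cases k
    · rw [pow_zero] at hkx
      rw [← hkx, orderOf_one] at hx
      omega
    · simpa using hkx.symm
  · rintro ⟨H, hH⟩
    obtain ⟨x, rfl⟩ := exists_zpowers_eq_of_card_prime hH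
    exact ⟨⟨x, by rwa [Nat.card_zpowers] at hH⟩, rfl⟩

theorem alternatingGroup_five_exists_inverted (x : alternatingGroup (Fin 5)) (hx : orderOf x = 2) :
    ∃ y : alternatingGroup (Fin 5), orderOf y = 3 ∧ x * y * x⁻¹ = y⁻¹ := by
  have key : ∀ x : alternatingGroup (Fin 5), x ^ 2 = 1 → x ≠ 1 →
      ∃ y : alternatingGroup (Fin 5), (y ^ 3 = 1 ∧ y ≠ 1) ∧ x * y * x⁻¹ = y⁻¹ := by
    decide +kernel
  have : Fact (Nat.Prime 3) := ⟨Nat.prime_three⟩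
  obtain ⟨h1, h2⟩ := orderOf_eq_prime_iff.mp hx
  obtain ⟨y, hy, hxy⟩ := key x h1 h2
  exact ⟨y, orderOf_eq_prime_iff.mpr hy, hxy⟩

theorem alternatingGroup_five_card_orderOf_eq_two :
    Nat.card {x : alternatingGroup (Fin 5) // orderOf x = 2} = 15 := by
  simp only [orderOf_eq_prime_iff]
  rw [Nat.card_eq_fintype_card]
  decide +kernel

end Involutions

theorem stmt_12 :
    delta (alternatingGroup (Fin 5)) = 16 ∧
    (∀ H : Subgroup (alternatingGroup (Fin 5)),
      ¬ AllMaxChainsSameLength H ↔ (H = ⊥ ∨ Nat.card H = 2)) ∧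
    Nat.card {H : Subgroup (alternatingGroup (Fin 5)) // Nat.card H = 2} = 15 := by
  have hG : Nat.card (alternatingGroup (Fin 5)) = 60 := by
    rw [nat_card_alternatingGroup, Nat.card_fin]
    rfl
  have h15 : Nat.card {H : Subgroup (alternatingGroup (Fin 5)) // Nat.card H = 2} = 15 :=
    (card_subgroup_card_eq_two _).trans alternatingGroup_five_card_orderOf_eq_two
  have hchains : ∀ H : Subgroup (alternatingGroup (Fin 5)), Nat.card H = 2 →
      (∃ c, IsMaxChainOf H 2 c) ∧ ∃ c, IsMaxChainOf H 3 c := by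
    intro H hH
    refine ⟨?_, exists_isMaxChainOf_three hG hH⟩
    obtain ⟨x, rfl⟩ := exists_zpowers_eq_of_card_prime hH
    rw [Nat.card_zpowers] at hH
    obtain ⟨y, hy, hxy⟩ := alternatingGroup_five_exists_inverted x hH
    exact exists_isMaxChainOf_two hG hH hy hxy
  have hiff : ∀ H : Subgroup (alternatingGroup (Fin 5)),
      ¬ AllMaxChainsSameLength H ↔ (H = ⊥ ∨ Nat.card H = 2) := by
    intro H
    constructor
    · intro h
      have h3 : ¬ 3 ≤ Nat.card H := fun h3 => h (allMaxChainsSameLength_of_three_le hG h3)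
      have hpos : 0 < Nat.card H := Nat.card_pos
      rw [← Subgroup.card_eq_one]
      omega
    · rintro (rfl | hH) h
      · obtain ⟨x, hx⟩ := exists_prime_orderOf_dvd_card' (G := alternatingGroup (Fin 5)) 2
          (by rw [hG]; decide)
        have hcx : Nat.card (Subgroup.zpowers x) = 2 := by rw [Nat.card_zpowers, hx]
        have hcov : ⊥ ⋖ Subgroup.zpowers x :=
          covBy_of_card_eq_mul_prime bot_le Nat.prime_two (by rw [hcx, Subgroup.card_bot])
        obtain ⟨⟨c, hc⟩, d, hd⟩ := hchains _ hcx
        have := h _ _ _ _ (hc.cons hcov) (hd.cons hcov)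
        omega
      · obtain ⟨⟨c, hc⟩, d, hd⟩ := hchains H hH
        have := h _ _ _ _ hc hd
        omega
  refine ⟨?_, hiff, h15⟩
  unfold delta
  simp only [hiff]
  classical
  rw [Nat.card_congr (subtypeOrEquiv _ _ ?_), Nat.card_sum, h15, Nat.card_unique]
  rw [Pi.disjoint_iff]
  intro H
  rw [Prop.disjoint_iff]
  by_contra! h
  obtain ⟨rfl, h⟩ := h
  simp at h
end
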